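/- arXiv:2502.06865 — 9 statements merged into one kernel-verified Lean document; each statement's English description precedes it below -/
import Mathlib

section
/- Let P, N : ℕ with N ≥ 1, let U_n : ℝ^P → ℝ² (for n = 1, …, N) and W_n : ℝ² → ℝ be continuously differentiable, and define I(θ) = (1/N) · Σ_{n=1}^N W_n(U_n(θ)). Let η > 0 and let θ : ℝ → ℝ^P solve θ'(t) = −η • ∇I(θ(t)). Then for all t, d/dt I(θ(t)) = −(η/N²) · Σ_{m=1}^N Σ_{n=1}^N ⟪∇W_m(U_m(θ(t))), K_{mn}(θ(t)).mulVec (∇W_n(U_n(θ(t))))⟫, where K_{mn}(θ) = (DU_m(θ)) · (DU_n(θ))ᵀ ∈ ℝ^{2×2} and DU_n(θ) ∈ ℝ^{2×P} is the Jacobian matrix of U_n at θ. -/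
open Matrix Real

theorem clm_eq_sum {k : ℕ} (L : (Fin k → ℝ) →L[ℝ] ℝ) (v : Fin k → ℝ) :
    L v = ∑ j, v j * L (Pi.single j 1) := by
  conv_lhs => rw [pi_eq_sum_univ' v]
  rw [map_sum]
  refine Finset.sum_congr rfl fun j _ => ?_
  rw [map_smul, smul_eq_mul]

/-- NTK form of the Deep Ritz loss dynamics (equation (13)): for the loss
`I(θ) = (1/N) Σₙ Wₙ(Uₙ(θ))` along the gradient flow `θ' = -η • ∇I(θ)`,
`d/dt I(θ(t)) = -(η/N²) Σₘ Σₙ ⟪∇Wₘ(Uₘ(θ)), K_{mn}(θ).mulVec ∇Wₙ(Uₙ(θ))⟫`,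
where `K_{mn}(θ) = DUₘ(θ) (DUₙ(θ))ᵀ` is built from the Jacobians `DUₙ(θ) ∈ ℝ^{2×P}`. -/
theorem drm_ntk_loss_dynamics
    (P N : ℕ) (hN : 1 ≤ N)
    (U : Fin N → (Fin P → ℝ) → Fin 2 → ℝ) (hU : ∀ n, ContDiff ℝ 1 (U n))
    (W : Fin N → (Fin 2 → ℝ) → ℝ) (hW : ∀ n, ContDiff ℝ 1 (W n))
    (I : (Fin P → ℝ) → ℝ)
    (hI : ∀ θ, I θ = (1 / (N : ℝ)) * ∑ n, W n (U n θ))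
    (gradI : (Fin P → ℝ) → Fin P → ℝ)
    (hgradI : ∀ x j, gradI x j = fderiv ℝ I x (Pi.single j 1))
    (gradW : Fin N → (Fin 2 → ℝ) → Fin 2 → ℝ)
    (hgradW : ∀ n v i, gradW n v i = fderiv ℝ (W n) v (Pi.single i 1))
    (DU : Fin N → (Fin P → ℝ) → Matrix (Fin 2) (Fin P) ℝ)
    (hDU : ∀ n θ i j, DU n θ i j = fderiv ℝ (U n) θ (Pi.single j 1) i)
    (K : Fin N → Fin N → (Fin P → ℝ) → Matrix (Fin 2) (Fin 2) ℝ)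
    (hK : ∀ m n θ, K m n θ = DU m θ * (DU n θ)ᵀ)
    (η : ℝ) (hη : 0 < η)
    (θ : ℝ → Fin P → ℝ)
    (hθ : ∀ t : ℝ, HasDerivAt θ (-η • gradI (θ t)) t) :
    ∀ t : ℝ,
      HasDerivAt (fun s => I (θ s))
        (-(η / (N : ℝ) ^ 2) *
          ∑ m, ∑ n,
            gradW m (U m (θ t)) ⬝ᵥ (K m n (θ t)).mulVec (gradW n (U n (θ t)))) t := by
  intro t
  have hIeq : I = fun x => (1 / (N : ℝ)) * ∑ n, W n (U n x) := funext hI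
  have hdI : ∀ x, HasFDerivAt I ((1 / (N : ℝ)) •
      ∑ n, (fderiv ℝ (W n) (U n x)).comp (fderiv ℝ (U n) x)) x := by
    intro x
    rw [hIeq]
    refine HasFDerivAt.const_mul ?_ _
    refine HasFDerivAt.fun_sum fun n _ => ?_
    exact HasFDerivAt.comp x
      (((hW n).differentiable (by norm_num)) (U n x)).hasFDerivAt
      (((hU n).differentiable (by norm_num)) x).hasFDerivAt
  have hg : ∀ x, gradI x = (1 / (N : ℝ)) • ∑ n, gradW n (U n x) ᵥ* DU n x := by
    intro x
    ext j
    rw [hgradI, (hdI x).fderiv]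
    simp only [_root_.smul_apply, _root_.sum_apply,
      ContinuousLinearMap.comp_apply, Pi.smul_apply, Finset.sum_apply]
    congr 1
    refine Finset.sum_congr rfl fun n _ => ?_
    rw [clm_eq_sum]
    simp only [vecMul, dotProduct, hgradW, hDU]
    exact Finset.sum_congr rfl fun i _ => mul_comm _ _
  have h := (hdI (θ t)).differentiableAt.hasFDerivAt.comp_hasDerivAt t (hθ t)
  have hval : fderiv ℝ I (θ t) (-η • gradI (θ t)) = -η * (gradI (θ t) ⬝ᵥ gradI (θ t)) := by
    rw [map_smul, clm_eq_sum, smul_eq_mul]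
    simp only [dotProduct, hgradI]
  rw [hval] at h
  have hk : ∀ m n, gradW m (U m (θ t)) ⬝ᵥ (K m n (θ t)).mulVec (gradW n (U n (θ t)))
      = (gradW m (U m (θ t)) ᵥ* DU m (θ t)) ⬝ᵥ (gradW n (U n (θ t)) ᵥ* DU n (θ t)) := by
    intro m n
    rw [hK, ← mulVec_mulVec, mulVec_transpose, dotProduct_mulVec]
  refine HasDerivAt.congr_deriv h ?_
  simp only [hk]
  rw [hg, smul_dotProduct, dotProduct_smul, sum_dotProduct]
  simp only [dotProduct_sum, smul_eq_mul]
  ring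
end

section
/- Let P, N : ℕ with N ≥ 1. For n = 1, …, N let a_n ∈ ℝ², let B_n ∈ ℝ^{2×P}, let U_n(θ) = a_n + B_n.mulVec θ, and let W_n : ℝ² → ℝ be twice continuously differentiable. Define I(θ) = (1/N) Σ_n W_n(U_n(θ)), let η > 0, and let θ : ℝ → ℝ^P solve θ'(t) = −η • ∇I(θ(t)). Define g(t) ∈ ℝ^{2N} as the concatenation of the gradients ∇W_n(U_n(θ(t))) ∈ ℝ², let M ∈ ℝ^{2N×2N} be the block matrix whose (m,n) 2×2 block is B_m Bᵀ_n, and let D(t) ∈ ℝ^{2N×2N} be the block-diagonal matrix whose n-th 2×2 diagonal block is the Hessian ∇²W_n(U_n(θ(t))). Then g is differentiable and g'(t) = −(η/N) • (D(t).mulVec (M.mulVec (g(t)))) for all t. -/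
open Matrix Real

theorem drm_clm_sum {k : ℕ} (L : (Fin k → ℝ) →L[ℝ] ℝ) (v : Fin k → ℝ) :
    L v = ∑ i, v i * L (Pi.single i 1) := by
  conv_lhs => rw [← Finset.univ_sum_single v]
  rw [map_sum]
  refine Finset.sum_congr rfl fun i _ => ?_
  have : (Pi.single i (v i) : Fin k → ℝ) = v i • Pi.single i 1 := by
    rw [← Pi.single_smul]; simp
  rw [this, map_smul, smul_eq_mul]

theorem drm_hess_symm (W : (Fin 2 → ℝ) → ℝ) (hW : ContDiff ℝ 2 W) (v x y : Fin 2 → ℝ) :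
    fderiv ℝ (fun z => fderiv ℝ W z x) v y = fderiv ℝ (fun z => fderiv ℝ W z y) v x := by
  have hd : DifferentiableAt ℝ (fderiv ℝ W) v :=
    ((hW.fderiv_right (m := 1) (by norm_num)).differentiable (by norm_num)) v
  have key : ∀ u w : Fin 2 → ℝ, fderiv ℝ (fun z => fderiv ℝ W z u) v w
      = fderiv ℝ (fderiv ℝ W) v w u := by
    intro u w
    rw [(hd.hasFDerivAt.clm_apply (hasFDerivAt_const u v)).fderiv]
    simp
  rw [key, key]
  exact (hW.contDiffAt.isSymmSndFDerivAt (by simp)) y x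

/-- Gradient-evolution equation (17) for the linearized Deep Ritz Method: for affine
network outputs `Uₙ(θ) = aₙ + Bₙ θ` and loss `I(θ) = (1/N) Σₙ Wₙ(Uₙ(θ))`, along the
gradient flow `θ' = -η • ∇I(θ)` the stacked gradients `g(t)` (concatenation of the
`∇Wₙ(Uₙ(θ(t))) ∈ ℝ²`) satisfy `g'(t) = -(η/N) • D(t) M g(t)`, where `M` is the block
Gram matrix with `(m,n)` block `Bₘ Bₙᵀ` and `D(t)` is the block-diagonal matrix of
Hessians `∇²Wₙ(Uₙ(θ(t)))`. -/
theorem drm_linearized_gradient_evolution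
    (P N : ℕ) (hN : 1 ≤ N)
    (a : Fin N → Fin 2 → ℝ) (B : Fin N → Matrix (Fin 2) (Fin P) ℝ)
    (U : Fin N → (Fin P → ℝ) → Fin 2 → ℝ)
    (hU : ∀ n θ, U n θ = a n + (B n).mulVec θ)
    (W : Fin N → (Fin 2 → ℝ) → ℝ) (hW : ∀ n, ContDiff ℝ 2 (W n))
    (I : (Fin P → ℝ) → ℝ)
    (hI : ∀ θ, I θ = (1 / (N : ℝ)) * ∑ n, W n (U n θ))
    (gradI : (Fin P → ℝ) → Fin P → ℝ)
    (hgradI : ∀ x j, gradI x j = fderiv ℝ I x (Pi.single j 1))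
    (gradW : Fin N → (Fin 2 → ℝ) → Fin 2 → ℝ)
    (hgradW : ∀ n v i, gradW n v i = fderiv ℝ (W n) v (Pi.single i 1))
    (Hess : Fin N → (Fin 2 → ℝ) → Matrix (Fin 2) (Fin 2) ℝ)
    (hHess : ∀ n v i j,
      Hess n v i j = fderiv ℝ (fun x => fderiv ℝ (W n) x (Pi.single j 1)) v (Pi.single i 1))
    (η : ℝ) (hη : 0 < η)
    (θ : ℝ → Fin P → ℝ)
    (hθ : ∀ t : ℝ, HasDerivAt θ (-η • gradI (θ t)) t)
    (g : ℝ → Fin N × Fin 2 → ℝ)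
    (hg : ∀ t p, g t p = gradW p.1 (U p.1 (θ t)) p.2)
    (M : Matrix (Fin N × Fin 2) (Fin N × Fin 2) ℝ)
    (hM : ∀ p q, M p q = (B p.1 * (B q.1)ᵀ) p.2 q.2)
    (D : ℝ → Matrix (Fin N × Fin 2) (Fin N × Fin 2) ℝ)
    (hD : ∀ t p q, D t p q = if p.1 = q.1 then Hess p.1 (U p.1 (θ t)) p.2 q.2 else 0) :
    ∀ t : ℝ, HasDerivAt g (-(η / (N : ℝ)) • ((D t).mulVec (M.mulVec (g t)))) t := by
  intro t
  have hUd : ∀ n x, HasFDerivAt (U n) (Matrix.mulVecLin (B n)).toContinuousLinearMap x := by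
    intro n x
    have h : U n = fun x => a n + (Matrix.mulVecLin (B n)).toContinuousLinearMap x := by
      funext x; simp [hU]
    rw [h]
    exact (ContinuousLinearMap.hasFDerivAt _).const_add _
  have hWd : ∀ n v, HasFDerivAt (W n) (fderiv ℝ (W n) v) v := fun n v =>
    ((hW n).differentiable (by norm_num) v).hasFDerivAt
  have hgI : ∀ x j, gradI x j = (1 / (N : ℝ)) * ∑ n, ∑ i, B n i j * gradW n (U n x) i := by
    intro x j
    have h : HasFDerivAt I ((1 / (N : ℝ)) • ∑ n, (fderiv ℝ (W n) (U n x)).comp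
        (Matrix.mulVecLin (B n)).toContinuousLinearMap) x := by
      have h0 : I = fun θ => (1 / (N : ℝ)) * ∑ n, W n (U n θ) := funext hI
      rw [h0]
      exact (HasFDerivAt.fun_sum fun n _ => (hWd n (U n x)).comp x (hUd n x)).const_mul _
    rw [hgradI, h.fderiv]
    simp only [ContinuousLinearMap.smul_apply, ContinuousLinearMap.sum_apply,
      ContinuousLinearMap.comp_apply, smul_eq_mul]
    congr 1
    refine Finset.sum_congr rfl fun n _ => ?_
    rw [drm_clm_sum]
    refine Finset.sum_congr rfl fun i _ => ?_
    rw [hgradW]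
    simp
  have hMg : ∀ n, (B n).mulVec (gradI (θ t))
      = fun j => (1 / (N : ℝ)) * (M.mulVec (g t)) (n, j) := by
    intro n
    funext j
    simp only [Matrix.mulVec, dotProduct, hgI, hM, hg, Fintype.sum_prod_type, Matrix.mul_apply,
      Matrix.transpose_apply, Finset.mul_sum, Finset.sum_mul]
    rw [Finset.sum_comm]
    refine Finset.sum_congr rfl fun m _ => ?_
    rw [Finset.sum_comm]
    refine Finset.sum_congr rfl fun i _ => ?_
    refine Finset.sum_congr rfl fun l _ => ?_
    ring
  rw [hasDerivAt_pi]
  rintro ⟨n, i⟩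
  have hFd : HasFDerivAt (fun z => fderiv ℝ (W n) z (Pi.single i 1))
      (fderiv ℝ (fun z => fderiv ℝ (W n) z (Pi.single i 1)) (U n (θ t))) (U n (θ t)) := by
    apply DifferentiableAt.hasFDerivAt
    exact (((hW n).fderiv_right (m := 1) (by norm_num)).differentiable (by norm_num) _).clm_apply
      (differentiableAt_const _)
  have hc := hFd.comp_hasDerivAt t ((hUd n (θ t)).comp_hasDerivAt t (hθ t))
  have hgf : (fun s => g s (n, i)) = (fun z => fderiv ℝ (W n) z (Pi.single i 1)) ∘ (U n ∘ θ) := by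
    funext s; simp [hg, hgradW]
  rw [hgf]
  refine hc.congr_deriv ?_
  rw [map_smul, map_smul]
  have h1 : (Matrix.mulVecLin (B n)).toContinuousLinearMap (gradI (θ t))
      = fun j => (1 / (N : ℝ)) * (M.mulVec (g t)) (n, j) := by
    rw [← hMg]; rfl
  rw [h1, drm_clm_sum]
  have h2 : (D t).mulVec (M.mulVec (g t)) (n, i)
      = ∑ j, Hess n (U n (θ t)) i j * (M.mulVec (g t)) (n, j) := by
    conv_lhs => rw [Matrix.mulVec, dotProduct]
    rw [Fintype.sum_prod_type, Finset.sum_eq_single n]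
    · simp [hD]
    · intro m _ hm
      simp [hD, hm.symm]
    · simp
  rw [Pi.smul_apply, h2, smul_eq_mul, smul_eq_mul, Finset.mul_sum, Finset.mul_sum]
  refine Finset.sum_congr rfl fun j _ => ?_
  rw [hHess, drm_hess_symm (W n) (hW n) _ (Pi.single j 1)]
  ring
end

section
/- Let P : ℕ, let I : ℝ^P → ℝ be convex, continuously differentiable, and bounded below, let η > 0, and let θ : [0,∞) → ℝ^P satisfy θ'(t) = −η • ∇I(θ(t)) for all t ≥ 0. Then I(θ(t)) → ⨅_{x ∈ ℝ^P} I(x) as t → ∞. -/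
open Matrix Real Filter

theorem drm_aux_convex {E : Type*} [NormedAddCommGroup E] [NormedSpace ℝ E] {I : E → ℝ}
    (hconv : ConvexOn ℝ Set.univ I) (hI : Differentiable ℝ I) (x y : E) :
    I x + fderiv ℝ I x (y - x) ≤ I y := by
  have hc : ConvexOn ℝ Set.univ (fun s : ℝ => I (AffineMap.lineMap x y s)) := by
    have := hconv.comp_affineMap (AffineMap.lineMap (k := ℝ) x y)
    rw [Set.preimage_univ] at this
    exact this
  have hd : HasDerivAt (fun s : ℝ => I (AffineMap.lineMap x y s)) (fderiv ℝ I x (y - x)) 0 := by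
    have h1 : HasDerivAt (fun s : ℝ => (AffineMap.lineMap x y s : E)) (y - x) 0 :=
      AffineMap.hasDerivAt_lineMap
    have h2 : HasFDerivAt I (fderiv ℝ I x) (AffineMap.lineMap x y (0 : ℝ)) := by
      simpa using (hI x).hasFDerivAt
    exact h2.comp_hasDerivAt (0 : ℝ) h1
  have := hc.le_slope_of_hasDerivAt (Set.mem_univ (0:ℝ)) (Set.mem_univ (1:ℝ)) one_pos hd
  simp [slope_def_field] at this
  simp
  linarith

/-- Second observation from the DRM loss dynamics (13): if the loss `I` is convex,
continuously differentiable and bounded below, the gradient flow `θ' = -η • ∇I(θ)`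
drives the loss to its global infimum: `I(θ(t)) → ⨅ x, I x` as `t → ∞`. -/
theorem drm_convex_loss_converges_to_infimum
    (P : ℕ) (I : (Fin P → ℝ) → ℝ)
    (hconv : ConvexOn ℝ Set.univ I)
    (hI : ContDiff ℝ 1 I)
    (hbd : BddBelow (Set.range I))
    (grad : (Fin P → ℝ) → Fin P → ℝ)
    (hgrad : ∀ x j, grad x j = fderiv ℝ I x (Pi.single j 1))
    (η : ℝ) (hη : 0 < η)
    (θ : ℝ → Fin P → ℝ)
    (hθ : ∀ t : ℝ, 0 ≤ t → HasDerivAt θ (-η • grad (θ t)) t) :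
    Tendsto (fun t => I (θ t)) atTop (nhds (⨅ x, I x)) := by
  have hdiff : Differentiable ℝ I := hI.differentiable (by norm_num)
  have hsum : ∀ x v, fderiv ℝ I x v = ∑ j, v j * grad x j := by
    intro x v
    conv_lhs => rw [pi_eq_sum_univ' v]
    rw [map_sum]
    refine Finset.sum_congr rfl fun j _ => ?_
    rw [map_smul, hgrad, smul_eq_mul]
  have key : ∀ y : Fin P → ℝ, ∀ t : ℝ, 0 ≤ t →
      2 * η * t * (I (θ t) - I y) ≤ ∑ j, (θ 0 j - y j) ^ 2 := by
    intro y t ht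
    have hder : ∀ s : ℝ, 0 ≤ s → HasDerivAt
        (fun s => 2 * η * s * (I (θ s) - I y) + ∑ j, (θ s j - y j) ^ 2)
        (2 * η * 1 * (I (θ s) - I y) + 2 * η * s * (fderiv ℝ I (θ s) (-η • grad (θ s)))
          + ∑ j, 2 * (θ s j - y j) * (-η * grad (θ s) j)) s := by
      intro s hs
      have hI' : HasDerivAt (fun s => I (θ s) - I y) (fderiv ℝ I (θ s) (-η • grad (θ s))) s :=
        ((hdiff (θ s)).hasFDerivAt.comp_hasDerivAt s (hθ s hs)).sub_const _
      refine HasDerivAt.add (((hasDerivAt_id s).const_mul (2 * η)).mul hI') ?_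
      refine HasDerivAt.fun_sum fun j _ => ?_
      have := (((hasDerivAt_pi.1 (hθ s hs)) j).sub_const (y j)).fun_pow 2
      simpa using this
    have hanti := antitoneOn_of_hasDerivWithinAt_nonpos (convex_Ici (0:ℝ))
      (fun s hs => (hder s hs).continuousAt.continuousWithinAt)
      (fun s hs => (hder s (interior_subset hs)).hasDerivWithinAt)
      (by
        intro s hs
        have hs0 : 0 ≤ s := interior_subset hs
        have h1 := drm_aux_convex hconv hdiff (θ s) y
        rw [hsum] at h1
        have h2 : fderiv ℝ I (θ s) (-η • grad (θ s)) ≤ 0 := by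
          rw [hsum]
          refine Finset.sum_nonpos fun j _ => ?_
          simp only [Pi.smul_apply, smul_eq_mul]
          nlinarith [mul_self_nonneg (grad (θ s) j)]
        have h3 : ∑ j, 2 * (θ s j - y j) * (-η * grad (θ s) j)
            = 2 * η * ∑ j, (y - θ s) j * grad (θ s) j := by
          rw [Finset.mul_sum]
          refine Finset.sum_congr rfl fun j _ => ?_
          simp only [Pi.sub_apply]
          ring
        rw [h3]
        have h4 : 2 * η * s * (fderiv ℝ I (θ s) (-η • grad (θ s))) ≤ 0 :=
          mul_nonpos_of_nonneg_of_nonpos (by positivity) h2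
        have h5 := mul_le_mul_of_nonneg_left h1 (by positivity : 0 ≤ 2 * η)
        linarith)
    have h := hanti (Set.mem_Ici.2 le_rfl) (Set.mem_Ici.2 ht) ht
    have hn : 0 ≤ ∑ j, (θ t j - y j) ^ 2 := Finset.sum_nonneg fun j _ => sq_nonneg _
    simp only [mul_zero, zero_mul, zero_add] at h
    linarith
  refine tendsto_order.2 ⟨fun a ha => Eventually.of_forall fun t =>
    ha.trans_le (ciInf_le hbd _), fun a ha => ?_⟩
  obtain ⟨y, hy⟩ := exists_lt_of_ciInf_lt ha
  have hlin : Tendsto (fun t : ℝ => 2 * η * (a - I y) * t) atTop atTop :=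
    tendsto_id.const_mul_atTop (mul_pos (by positivity) (sub_pos.2 hy))
  filter_upwards [hlin.eventually_gt_atTop (∑ j, (θ 0 j - y j) ^ 2), eventually_gt_atTop 0]
    with t h1 h2
  have h3 := key y t h2.le
  have h4 : (2 * η * t) * (I (θ t) - I y) < (2 * η * t) * (a - I y) := by linarith
  have := lt_of_mul_lt_mul_left h4 (by positivity)
  linarith
end

section
/- For every integer n ≥ 1, the sawtooth function u_n(x) = infDist x ((1/n) • ℤ) satisfies u_n(0) = u_n(1) = 0 and ∫_0^1 (((deriv u_n x)² − 1)² + (u_n x)²) dx ≤ 1/(4n²). Consequently, the infimum of I₂(u) = ∫_0^1 (((deriv u x)² − 1)² + (u x)²) dx over Lipschitz u : ℝ → ℝ with u(0) = u(1) = 0 equals 0. -/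
open MeasureTheory
open scoped Pointwise

/-- The sawtooth function of frequency `n`: the distance from `x` to the set of
integer multiples of `1/n`. -/
noncomputable def sawtooth (n : ℕ) (x : ℝ) : ℝ :=
  Metric.infDist x ((1 / (n : ℝ)) • (Set.range ((↑) : ℤ → ℝ)))

lemma sawtooth_eq (n : ℕ) (hn : 1 ≤ n) (x : ℝ) (j : ℤ) (h : |(n:ℝ) * x - j| ≤ 1 / 2) :
    sawtooth n x = |x - j / n| := by
  have hn0 : (0:ℝ) < n := by exact_mod_cast hn
  have key : ∀ k : ℤ, (n:ℝ) * |x - k / n| = |(n:ℝ) * x - k| := by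
    intro k
    rw [← abs_of_pos hn0, ← abs_mul, abs_of_pos hn0]
    congr 1
    field_simp
  unfold sawtooth
  apply le_antisymm
  · have := Metric.infDist_le_dist_of_mem (x := x)
      (s := (1 / (n : ℝ)) • (Set.range ((↑) : ℤ → ℝ))) (y := (j:ℝ) / n)
      ⟨(j:ℝ), ⟨j, rfl⟩, by simp only [smul_eq_mul]; ring⟩
    rwa [Real.dist_eq] at this
  · rw [Metric.le_infDist (Set.Nonempty.smul_set (Set.range_nonempty _))]
    rintro y ⟨_, ⟨k, rfl⟩, rfl⟩
    have e : (1 / (n:ℝ)) • (k:ℝ) = k / n := by simp only [smul_eq_mul]; ring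
    simp only [e]
    rw [Real.dist_eq]
    refine le_of_mul_le_mul_left ?_ hn0
    rw [key, key]
    by_cases hjk : j = k
    · rw [hjk]
    · have h1 : (1:ℝ) ≤ |(j:ℝ) - k| := by
        exact_mod_cast Int.one_le_abs (sub_ne_zero.mpr hjk)
      have h2 := abs_sub_le (j:ℝ) ((n:ℝ) * x) k
      rw [abs_sub_comm (j:ℝ) ((n:ℝ) * x)] at h2
      linarith

lemma sawtooth_le (n : ℕ) (hn : 1 ≤ n) (x : ℝ) : (sawtooth n x) ^ 2 ≤ 1 / (4 * (n:ℝ) ^ 2) := by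
  have hn0 : (0:ℝ) < n := by exact_mod_cast hn
  have h := abs_sub_round ((n:ℝ) * x)
  rw [sawtooth_eq n hn x _ h, sq_abs]
  have h2 : ((n:ℝ) * x - round ((n:ℝ) * x)) ^ 2 ≤ (1 / 2) ^ 2 := by
    rw [← sq_abs]; gcongr
  rw [le_div_iff₀ (by positivity)]
  have e : (x - (round ((n:ℝ) * x) : ℝ) / n) ^ 2 * (4 * (n:ℝ) ^ 2)
      = 4 * ((n:ℝ) * x - round ((n:ℝ) * x)) ^ 2 := by
    field_simp
  rw [e]; linarith

lemma sawtooth_deriv (n : ℕ) (hn : 1 ≤ n) (x : ℝ) (hx : ∀ m : ℤ, x ≠ m / (2 * n)) :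
    (deriv (sawtooth n) x) ^ 2 = 1 := by
  have hn0 : (0:ℝ) < n := by exact_mod_cast hn
  set j := round ((n:ℝ) * x) with hj
  have h : |(n:ℝ) * x - j| ≤ 1 / 2 := abs_sub_round ((n:ℝ) * x)
  have hlt : |(n:ℝ) * x - j| < 1 / 2 := by
    refine lt_of_le_of_ne h fun he => ?_
    rcases (abs_eq (by norm_num)).1 he with he | he
    · apply hx (2 * j + 1)
      rw [eq_div_iff (by positivity)]; push_cast; linarith
    · apply hx (2 * j - 1)
      rw [eq_div_iff (by positivity)]; push_cast; linarith
  have hne : x - j / n ≠ 0 := by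
    intro he
    apply hx (2 * j)
    push_cast
    rw [mul_div_mul_left _ _ two_ne_zero]; linarith
  have hev : sawtooth n =ᶠ[nhds x] fun y => |y - j / n| := by
    have hc : Continuous fun y : ℝ => |(n:ℝ) * y - j| := by fun_prop
    filter_upwards [hc.continuousAt.eventually_lt continuousAt_const hlt] with y hy
    exact sawtooth_eq n hn y j hy.le
  rw [hev.deriv_eq]
  have hid : HasDerivAt (fun y : ℝ => y - j / n) 1 x := (hasDerivAt_id x).sub_const _
  rcases lt_or_gt_of_ne hne with h0 | h0
  · have := (hasDerivAt_abs_neg h0).comp x hid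
    have e := this.deriv
    simp only [Function.comp_def] at e
    rw [e]; norm_num
  · have := (hasDerivAt_abs_pos h0).comp x hid
    have e := this.deriv
    simp only [Function.comp_def] at e
    rw [e]; norm_num

lemma sawtooth_energy (n : ℕ) (hn : 1 ≤ n) :
    (∫ x in (0:ℝ)..1, (((deriv (sawtooth n) x) ^ 2 - 1) ^ 2 + (sawtooth n x) ^ 2)) ≤
        1 / (4 * (n : ℝ) ^ 2) := by
  have hc : (Set.range fun m : ℤ => (m:ℝ) / (2 * n)).Countable := Set.countable_range _
  have hb : ‖∫ x in (0:ℝ)..1, (((deriv (sawtooth n) x) ^ 2 - 1) ^ 2 + (sawtooth n x) ^ 2)‖ ≤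
      1 / (4 * (n : ℝ) ^ 2) * |1 - 0| := by
    apply intervalIntegral.norm_integral_le_of_norm_le_const_ae
    filter_upwards [hc.ae_notMem volume] with x hx _
    rw [sawtooth_deriv n hn x (fun m hm => hx ⟨m, hm.symm⟩)]
    rw [Real.norm_of_nonneg (by positivity)]
    simpa using sawtooth_le n hn x
  rw [sub_zero, abs_one, mul_one] at hb
  exact (le_abs_self _).trans hb

lemma sawtooth_bc (n : ℕ) (hn : 1 ≤ n) : sawtooth n 0 = 0 ∧ sawtooth n 1 = 0 := by
  have hn0 : (0:ℝ) < n := by exact_mod_cast hn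
  constructor
  · rw [sawtooth_eq n hn 0 0 (by norm_num)]; simp
  · rw [sawtooth_eq n hn 1 n (by norm_num)]; simp [hn0.ne']

/-- 1D Benchmark Problem #2: the sawtooth `uₙ` satisfies the boundary conditions and
`I₂(uₙ) ≤ 1/(4n²)`; consequently the infimum of
`I₂(u) = ∫₀¹ ((u')² − 1)² + u² dx` over Lipschitz `u` with `u(0)=u(1)=0` is `0`. -/
theorem sawtooth_energy_bound_and_infimum_zero :
    (∀ n : ℕ, 1 ≤ n →
      sawtooth n 0 = 0 ∧ sawtooth n 1 = 0 ∧
      (∫ x in (0:ℝ)..1,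
        (((deriv (sawtooth n) x) ^ 2 - 1) ^ 2 + (sawtooth n x) ^ 2)) ≤
        1 / (4 * (n : ℝ) ^ 2)) ∧
    sInf {c : ℝ | ∃ u : ℝ → ℝ, (∃ K, LipschitzWith K u) ∧ u 0 = 0 ∧ u 1 = 0 ∧
      c = ∫ x in (0:ℝ)..1, (((deriv u x) ^ 2 - 1) ^ 2 + (u x) ^ 2)} = 0 := by
  refine ⟨fun n hn => ⟨(sawtooth_bc n hn).1, (sawtooth_bc n hn).2, sawtooth_energy n hn⟩, ?_⟩
  set S := {c : ℝ | ∃ u : ℝ → ℝ, (∃ K, LipschitzWith K u) ∧ u 0 = 0 ∧ u 1 = 0 ∧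
      c = ∫ x in (0:ℝ)..1, (((deriv u x) ^ 2 - 1) ^ 2 + (u x) ^ 2)} with hS
  have hpos : ∀ c ∈ S, 0 ≤ c := by
    rintro c ⟨u, _, _, _, rfl⟩
    exact intervalIntegral.integral_nonneg zero_le_one fun x _ => by positivity
  apply le_antisymm _ (Real.sInf_nonneg hpos)
  have hle : ∀ n : ℕ, sInf S ≤ 1 / ((n:ℝ) + 1) := by
    intro n
    have h1 : 1 ≤ n + 1 := by omega
    have hm := csInf_le ⟨0, hpos⟩ (show _ ∈ S from ⟨sawtooth (n + 1),
      ⟨1, Metric.lipschitz_infDist_pt _⟩, (sawtooth_bc _ h1).1, (sawtooth_bc _ h1).2, rfl⟩)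
    refine hm.trans ((sawtooth_energy _ h1).trans ?_)
    push_cast
    apply one_div_le_one_div_of_le (by positivity)
    have : (0:ℝ) ≤ n := n.cast_nonneg
    nlinarith
  exact ge_of_tendsto' tendsto_one_div_add_atTop_nhds_zero_nat hle
end

section
/- For every Lipschitz function u : ℝ → ℝ with u(0) = u(1) = 0, one has ∫_0^1 (((deriv u x)² − 1)² + (u x)²) dx > 0. In particular, since the infimum of I₂ over this admissible class is 0, the infimum is not attained: the minimization problem I₂ has no minimizer. -/
open MeasureTheory

theorem dw_pos (u : ℝ → ℝ) (hu : ∃ K, LipschitzWith K u) :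
    0 < ∫ x in (0:ℝ)..1, (((deriv u x) ^ 2 - 1) ^ 2 + (u x) ^ 2) := by
  obtain ⟨K, hK⟩ := hu
  have hm : Measurable (deriv u) := measurable_deriv u
  have hb : ∀ x, |deriv u x| ≤ K := fun x => by
    simpa using norm_deriv_le_of_lipschitz (x₀ := x) hK
  have hA : IntervalIntegrable (fun x => ((deriv u x) ^ 2 - 1) ^ 2) volume 0 1 := by
    rw [intervalIntegrable_iff]
    refine Measure.integrableOn_of_bounded (M := ((K:ℝ)^2 + 1)^2) (by simp)
      (((hm.pow_const 2).sub_const 1).pow_const 2).aestronglyMeasurable ?_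
    refine Filter.Eventually.of_forall fun x => ?_
    rw [Real.norm_eq_abs, abs_of_nonneg (by positivity), ← sq_abs]
    have h2 : (deriv u x)^2 ≤ (K:ℝ)^2 := by
      rw [← sq_abs]; exact pow_le_pow_left₀ (abs_nonneg _) (hb x) 2
    refine pow_le_pow_left₀ (abs_nonneg _) ?_ 2
    rw [abs_le]; constructor <;> nlinarith [sq_nonneg (deriv u x), sq_nonneg (K:ℝ)]
  have hc : Continuous (fun x => (u x)^2) := hK.continuous.pow 2
  have hB : IntervalIntegrable (fun x => (u x)^2) volume 0 1 := hc.intervalIntegrable _ _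
  rw [intervalIntegral.integral_add hA hB]
  have hA0 : 0 ≤ ∫ x in (0:ℝ)..1, ((deriv u x) ^ 2 - 1) ^ 2 :=
    intervalIntegral.integral_nonneg (by norm_num) fun x _ => by positivity
  by_cases h : ∃ c ∈ Set.Icc (0:ℝ) 1, 0 < (u c)^2
  · have := intervalIntegral.integral_pos (by norm_num) hc.continuousOn
      (fun x _ => sq_nonneg (u x)) h
    linarith
  · push Not at h
    have hz : ∀ x ∈ Set.Icc (0:ℝ) 1, u x = 0 := fun x hx =>
      pow_eq_zero_iff (two_ne_zero) |>.1 (le_antisymm (h x hx) (sq_nonneg _))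
    have hB0 : 0 ≤ ∫ x in (0:ℝ)..1, (u x) ^ 2 :=
      intervalIntegral.integral_nonneg (by norm_num) fun x _ => by positivity
    have : ∫ x in (0:ℝ)..1, ((deriv u x) ^ 2 - 1) ^ 2 = ∫ x in (0:ℝ)..1, (1:ℝ) := by
      refine intervalIntegral.integral_congr_Ioo_of_le (by norm_num) ?_
      intro x hx
      have : u =ᶠ[nhds x] fun _ => (0:ℝ) := by
        filter_upwards [Ioo_mem_nhds hx.1 hx.2] with y hy
        exact hz y ⟨hy.1.le, hy.2.le⟩
      simp [this.deriv_eq]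
    rw [this]
    simp
    linarith

theorem dw_saw (y : ℝ) (h1 : ∀ k : ℤ, 2 * y ≠ k) :
    ∃ d : ℝ, d ^ 2 = 1 ∧ HasDerivAt (fun y : ℝ => |y - round y|) d y := by
  have hlt : |y - round y| < 1/2 := by
    refine lt_of_le_of_ne (abs_sub_round y) fun h => ?_
    rcases abs_choice (y - round y) with h' | h' <;> rw [h'] at h
    · apply h1 (2 * round y + 1); push_cast; linarith
    · apply h1 (2 * round y - 1); push_cast; linarith
  have hne : y - round y ≠ 0 := fun h => by
    apply h1 (2 * round y); push_cast; linarith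
  have hev : (fun z : ℝ => |z - round z|) =ᶠ[nhds y] fun z => |z - round y| := by
    have : ∀ᶠ z : ℝ in nhds y, |z - round y| < 1/2 :=
      (by fun_prop : Continuous fun z : ℝ => |z - round y|).continuousAt.eventually_lt
        continuousAt_const hlt
    filter_upwards [this] with z hz
    have : round z = round y := by
      rw [round_eq, Int.floor_eq_iff]
      rw [abs_lt] at hz
      constructor <;> linarith [hz.1, hz.2]
    rw [this]
  rcases lt_or_gt_of_ne hne with hn | hp
  · refine ⟨-1, by norm_num, HasDerivAt.congr_of_eventuallyEq ?_ hev⟩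
    have h := HasDerivAt.comp y (hasDerivAt_abs_neg hn) ((hasDerivAt_id' y).sub_const (round y : ℝ))
    rw [mul_one] at h
    exact h
  · refine ⟨1, by norm_num, HasDerivAt.congr_of_eventuallyEq ?_ hev⟩
    have h := HasDerivAt.comp y (hasDerivAt_abs_pos hp) ((hasDerivAt_id' y).sub_const (round y : ℝ))
    rw [mul_one] at h
    exact h

theorem dw_saw_lip : LipschitzWith 1 (fun y : ℝ => |y - round y|) := by
  refine LipschitzWith.of_le_add fun x y => ?_
  have h := round_le x (round y)
  have h2 := abs_sub_le x y (round y)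
  rw [Real.dist_eq]
  linarith

theorem dw_approx (ε : ℝ) (hε : 0 < ε) : ∃ v : ℝ → ℝ, (∃ K, LipschitzWith K v) ∧
    v 0 = 0 ∧ v 1 = 0 ∧ (∫ x in (0:ℝ)..1, (((deriv v x) ^ 2 - 1) ^ 2 + (v x) ^ 2)) < ε := by
  obtain ⟨m, hm⟩ := exists_nat_one_div_lt hε
  set n : ℕ := m + 1 with hn
  have hn1 : (1:ℝ) ≤ n := by rw [hn]; push_cast; linarith [Nat.cast_nonneg (α := ℝ) m]
  have hn0 : (n:ℝ) ≠ 0 := by positivity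
  set g : ℝ → ℝ := fun y : ℝ => |y - round y| with hg
  have hL : LipschitzWith (1 : NNReal) (fun x : ℝ => (n:ℝ)⁻¹ * g (n * x)) := by
    refine LipschitzWith.of_dist_le_mul fun x y => ?_
    have := dw_saw_lip.dist_le_mul (n * x) (n * y)
    simp only [Real.dist_eq, NNReal.coe_one, one_mul] at this ⊢
    change |g (n * x) - g (n * y)| ≤ _ at this
    rw [← mul_sub, abs_mul, abs_of_pos (by positivity : (0:ℝ) < n)] at this
    rw [← mul_sub, abs_mul, abs_of_pos (by positivity : (0:ℝ) < (n:ℝ)⁻¹)]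
    calc _ ≤ (n:ℝ)⁻¹ * (n * |x - y|) := by gcongr
      _ = _ := by field_simp
  refine ⟨fun x => (n:ℝ)⁻¹ * g (n * x), ⟨1, hL⟩, by simp [hg], by simp [hg], ?_⟩
  have hae : ∀ᵐ x : ℝ, deriv (fun x => (n:ℝ)⁻¹ * g (n * x)) x ^ 2 = 1 := by
    have hcnt : (Set.range fun k : ℤ => (k:ℝ) / (2 * n)).Countable := Set.countable_range _
    filter_upwards [hcnt.ae_notMem volume] with x hx
    obtain ⟨d, hd, hd'⟩ := dw_saw (n * x) (fun k hk => hx ⟨k, by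
      simp only [← hk]; field_simp⟩)
    have h3 : HasDerivAt (fun x : ℝ => (n:ℝ) * x) n x := by
      simpa using (hasDerivAt_id x).const_mul (n:ℝ)
    have h4 := (HasDerivAt.comp x hd' h3).const_mul (n:ℝ)⁻¹
    have h5 : (n:ℝ)⁻¹ * (d * n) = d := by field_simp
    rw [h5] at h4
    have h6 : deriv (fun x => (n:ℝ)⁻¹ * g (n * x)) x = d := h4.deriv
    rw [h6, hd]
  have hc := hL.continuous
  set v : ℝ → ℝ := fun x => (n:ℝ)⁻¹ * g (n * x) with hv
  have e1 : (∫ x in (0:ℝ)..1, (((deriv v x) ^ 2 - 1) ^ 2 + (v x) ^ 2)) =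
      ∫ x in (0:ℝ)..1, (v x) ^ 2 := by
    refine intervalIntegral.integral_congr_ae ?_
    filter_upwards [hae] with x hx _
    rw [hx]; ring
  rw [e1]
  have hle : ∫ x in (0:ℝ)..1, (v x) ^ 2 ≤ ∫ x in (0:ℝ)..1, (n:ℝ)⁻¹ := by
    refine intervalIntegral.integral_mono_on (by norm_num) ((hc.pow 2).intervalIntegrable _ _)
      (by simp) fun x _ => ?_
    have h0 : 0 ≤ g (n * x) := abs_nonneg _
    have h1 : g (n * x) ≤ 1 / 2 := abs_sub_round _
    have hi0 : 0 ≤ (n:ℝ)⁻¹ := by positivity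
    have hi : (n:ℝ)⁻¹ ≤ 1 := inv_le_one_of_one_le₀ hn1
    have hv0 : 0 ≤ v x := mul_nonneg hi0 h0
    have hv1 : v x ≤ (n:ℝ)⁻¹ := mul_le_of_le_one_right hi0 (by linarith)
    nlinarith
  have hm' : (n:ℝ)⁻¹ < ε := by rw [hn]; push_cast; simpa using hm
  simp at hle
  linarith


/-- 1D Benchmark Problem #2: every admissible Lipschitz `u` with `u(0)=u(1)=0` has
strictly positive energy `I₂(u) = ∫₀¹ ((u')² − 1)² + u² dx > 0`; in particular (the
infimum being `0`) the infimum is not attained: `I₂` has no minimizer. -/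
theorem double_well_lower_order_no_minimizer :
    (∀ u : ℝ → ℝ, (∃ K, LipschitzWith K u) → u 0 = 0 → u 1 = 0 →
      0 < ∫ x in (0:ℝ)..1, (((deriv u x) ^ 2 - 1) ^ 2 + (u x) ^ 2)) ∧
    ¬ ∃ u : ℝ → ℝ, (∃ K, LipschitzWith K u) ∧ u 0 = 0 ∧ u 1 = 0 ∧
      ∀ v : ℝ → ℝ, (∃ K, LipschitzWith K v) → v 0 = 0 → v 1 = 0 →
        (∫ x in (0:ℝ)..1, (((deriv u x) ^ 2 - 1) ^ 2 + (u x) ^ 2)) ≤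
          (∫ x in (0:ℝ)..1, (((deriv v x) ^ 2 - 1) ^ 2 + (v x) ^ 2)) := by
  refine ⟨fun u hu _ _ => dw_pos u hu, ?_⟩
  rintro ⟨u, hu, _, _, hmin⟩
  obtain ⟨v, hv, hv0, hv1, hlt⟩ := dw_approx _ (dw_pos u hu)
  exact absurd (hmin v hv hv0 hv1) (not_le.2 hlt)
end

section
/- Let u_n(x) = infDist x ((1/n) • ℤ) be the sawtooth functions and v_n = deriv u_n their a.e.-defined derivatives. Then: (i) for every continuous function φ : ℝ → ℝ, ∫_0^1 v_n(x) φ(x) dx → 0 as n → ∞ (the derivatives converge weakly to 0 in L²(0,1)); (ii) ∫_0^1 (v_n x)² dx = 1 for every n ≥ 1, so ‖v_n‖_{L²(0,1)} = 1 and v_n does not converge to 0 strongly in L²(0,1). -/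
open MeasureTheory Filter
open scoped Pointwise

lemma saw_eq {n : ℕ} (hn : 1 ≤ n) (k : ℤ) (y : ℝ) (h : |y - k / n| ≤ 1 / (2 * n)) :
    sawtooth n y = |y - k / n| := by
  have hn0 : (0:ℝ) < n := by exact_mod_cast hn
  unfold sawtooth
  apply le_antisymm
  · have hm : (k / n : ℝ) ∈ ((1 / (n : ℝ)) • (Set.range ((↑) : ℤ → ℝ))) := by
      refine ⟨k, ⟨k, rfl⟩, ?_⟩
      simp [smul_eq_mul]; ring
    simpa [Real.dist_eq] using Metric.infDist_le_dist_of_mem (x := y) hm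
  · have hne : ((1 / (n : ℝ)) • (Set.range ((↑) : ℤ → ℝ))).Nonempty :=
      (Set.range_nonempty _).smul_set
    rw [Metric.le_infDist hne]
    rintro _ ⟨_, ⟨j, rfl⟩, rfl⟩
    simp only [smul_eq_mul, Real.dist_eq]
    by_cases hjk : j = k
    · subst hjk
      apply le_of_eq; congr 2; ring
    · have h1 : (1:ℝ) ≤ |(k:ℝ) - j| := by
        have : (1:ℤ) ≤ |k - j| := Int.one_le_abs (sub_ne_zero.2 (Ne.symm hjk))
        exact_mod_cast this
      have h2 : |(k / n : ℝ) - 1 / n * j| = |(k:ℝ) - j| / n := by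
        rw [show (k / n : ℝ) - 1 / n * j = (k - j) / n by ring, abs_div, abs_of_pos hn0]
      have h3 : (1:ℝ) / n ≤ |(k / n : ℝ) - 1 / n * j| := by
        rw [h2]; gcongr
      have h4 : |(k / n : ℝ) - 1 / n * j| ≤ |y - k / n| + |y - 1 / n * j| := by
        rw [abs_sub_comm y (k / n)]
        exact abs_sub_le _ _ _
      have h5 : (1:ℝ) / n = 1 / (2 * n) + 1 / (2 * n) := by field_simp; norm_num
      linarith

lemma round_close {n : ℕ} (hn : 1 ≤ n) (y : ℝ) :
    |y - (round (n * y) : ℤ) / n| ≤ 1 / (2 * n) := by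
  have hn0 : (0:ℝ) < n := by exact_mod_cast hn
  have := abs_sub_round ((n:ℝ) * y)
  rw [show y - (round (n * y) : ℤ) / n = (n * y - (round (n * y) : ℤ)) / n by field_simp,
    abs_div, abs_of_pos hn0, div_le_div_iff₀ hn0 (by positivity)]
  nlinarith

lemma saw_shift {n : ℕ} (hn : 1 ≤ n) (y : ℝ) :
    sawtooth n (y + 1 / (2 * n)) = 1 / (2 * n) - sawtooth n y := by
  have hn0 : (0:ℝ) < n := by exact_mod_cast hn
  have hc := round_close hn y
  rw [saw_eq hn _ y hc]
  set k := round ((n:ℝ) * y)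
  have h5 : (1:ℝ) / n = 1 / (2 * n) + 1 / (2 * n) := by field_simp; norm_num
  rcases le_total (0:ℝ) (y - k / n) with h | h
  · rw [abs_of_nonneg h] at hc ⊢
    have e : y + 1 / (2 * n) - ((k + 1 : ℤ) : ℝ) / n = - (1 / (2 * n) - (y - k / n)) := by
      push_cast; rw [add_div, h5]; ring
    have e2 : |y + 1 / (2 * n) - ((k + 1 : ℤ) : ℝ) / n| = 1 / (2 * n) - (y - k / n) := by
      rw [e, abs_neg, abs_of_nonneg (by linarith)]
    rw [saw_eq hn (k+1) _ (by rw [e2]; linarith), e2]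
  · rw [abs_of_nonpos h] at hc ⊢
    have e2 : |y + 1 / (2 * n) - (k : ℝ) / n| = 1 / (2 * n) + (y - k / n) := by
      rw [abs_of_nonneg (by linarith)]; ring
    rw [saw_eq hn k _ (by rw [e2]; linarith), e2]; ring

lemma deriv_shift {n : ℕ} (hn : 1 ≤ n) (y : ℝ) :
    deriv (sawtooth n) (y + 1 / (2 * n)) = - deriv (sawtooth n) y := by
  rw [← deriv_comp_add_const]
  simp only [saw_shift hn]
  rw [deriv_const_sub]

lemma deriv_bound (n : ℕ) (y : ℝ) : |deriv (sawtooth n) y| ≤ 1 := by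
  have : LipschitzWith 1 (sawtooth n) := Metric.lipschitz_infDist_pt _
  simpa using norm_deriv_le_of_lipschitz (x₀ := y) this

lemma deriv_sq {n : ℕ} (hn : 1 ≤ n) (y : ℝ)
    (hy : y ∉ Set.range (fun k : ℤ => (k : ℝ) / (2 * n))) :
    deriv (sawtooth n) y ^ 2 = 1 := by
  have hn0 : (0:ℝ) < n := by exact_mod_cast hn
  have hc := round_close hn y
  set k := round ((n:ℝ) * y)
  have hne : y - k / n ≠ 0 := by
    intro h
    apply hy
    refine ⟨2 * k, ?_⟩
    have : y = k / n := by linarith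
    rw [this]; push_cast; field_simp
  have hlt : |y - k / n| < 1 / (2 * n) := by
    refine lt_of_le_of_ne hc fun h => hy ?_
    rcases eq_or_eq_neg_of_abs_eq h with h | h
    · refine ⟨2 * k + 1, ?_⟩
      have : y = k / n + 1 / (2 * n) := by linarith
      rw [this]; push_cast; field_simp
    · refine ⟨2 * k - 1, ?_⟩
      have : y = k / n - 1 / (2 * n) := by linarith
      rw [this]; push_cast; field_simp
  have hev : sawtooth n =ᶠ[nhds y] fun z => |z - k / n| := by
    have hcont : Continuous fun z : ℝ => |z - k / n| := by fun_prop
    filter_upwards [hcont.continuousAt.eventually_lt continuousAt_const hlt] with z hz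
    exact saw_eq hn k z hz.le
  rw [hev.deriv_eq]
  rcases lt_or_gt_of_ne hne with h | h
  · have := (hasDerivAt_abs_neg h).comp y ((hasDerivAt_id y).sub_const (k / n : ℝ))
    have h2 := this.deriv
    simp only [Function.comp_def, id] at h2
    rw [h2]; norm_num
  · have := (hasDerivAt_abs_pos h).comp y ((hasDerivAt_id y).sub_const (k / n : ℝ))
    have h2 := this.deriv
    simp only [Function.comp_def, id] at h2
    rw [h2]; norm_num

lemma integral_sq {n : ℕ} (hn : 1 ≤ n) :
    (∫ x in (0:ℝ)..1, (deriv (sawtooth n) x) ^ 2) = 1 := by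
  have : (∫ x in (0:ℝ)..1, (deriv (sawtooth n) x) ^ 2) = ∫ x in (0:ℝ)..1, (1:ℝ) := by
    apply intervalIntegral.integral_congr_ae
    have hc : (Set.range (fun k : ℤ => (k : ℝ) / (2 * n))).Countable := Set.countable_range _
    filter_upwards [hc.ae_notMem volume] with x hx _
    exact deriv_sq hn x hx
  rw [this]; simp

lemma int_vf (n : ℕ) (f : ℝ → ℝ) (hf : Continuous f) (a b : ℝ) :
    IntervalIntegrable (fun x => deriv (sawtooth n) x * f x) volume a b := by
  have key : ∀ c d : ℝ, IntegrableOn f (Set.Ioc c d) volume →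
      IntegrableOn (fun x => deriv (sawtooth n) x * f x) (Set.Ioc c d) volume := by
    intro c d h
    refine Integrable.bdd_mul (c := 1) h (measurable_deriv _).aestronglyMeasurable ?_
    exact Eventually.of_forall fun x => by simpa using deriv_bound n x
  exact ⟨key _ _ (hf.intervalIntegrable a b).1, key _ _ (hf.intervalIntegrable a b).2⟩

lemma two_int {n : ℕ} (hn : 1 ≤ n) (f : ℝ → ℝ) (hf : Continuous f) :
    2 * (∫ x in (0:ℝ)..1, deriv (sawtooth n) x * f x) =
      (∫ x in (0:ℝ)..1, deriv (sawtooth n) x * (f x - f (x + 1 / (2 * n)))) +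
      (∫ x in (0:ℝ)..(0 + 1 / (2 * n)), deriv (sawtooth n) x * f x) -
      ∫ x in (1:ℝ)..(1 + 1 / (2 * n)), deriv (sawtooth n) x * f x := by
  have hf' : Continuous fun x => f (x + 1 / (2 * (n:ℝ))) := by fun_prop
  have h1 := intervalIntegral.integral_comp_add_right (a := 0) (b := 1)
    (fun x => deriv (sawtooth n) x * f x) (1 / (2 * (n:ℝ)))
  simp only [deriv_shift hn, neg_mul, intervalIntegral.integral_neg] at h1
  have h2 := intervalIntegral.integral_sub (int_vf n f hf 0 1) (int_vf n _ hf' 0 1)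
  simp only [← mul_sub] at h2
  have h3 := intervalIntegral.integral_add_adjacent_intervals (int_vf n f hf 0 1)
    (int_vf n f hf 1 (1 + 1 / (2 * n)))
  have h4 := intervalIntegral.integral_add_adjacent_intervals
    (int_vf n f hf 0 (0 + 1 / (2 * n)))
    (int_vf n f hf (0 + 1 / (2 * n)) (1 + 1 / (2 * n)))
  linarith

lemma tendsto_h : Tendsto (fun n : ℕ => 1 / (2 * (n:ℝ))) atTop (nhds 0) := by
  have := (tendsto_one_div_atTop_nhds_zero_nat (𝕜 := ℝ)).const_mul (1/2)
  simp only [mul_zero] at this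
  refine this.congr fun n => ?_
  ring

lemma h_le (n : ℕ) : 1 / (2 * (n:ℝ)) ≤ 1 := by
  rcases Nat.eq_zero_or_pos n with rfl | h
  · simp
  · have : (1:ℝ) ≤ n := by exact_mod_cast h
    rw [div_le_one (by positivity)]; linarith

lemma tendsto_small (f : ℝ → ℝ) (C : ℝ) (hC : ∀ x ∈ Set.Icc (0:ℝ) 2, |f x| ≤ C)
    (a : ℝ) (ha0 : 0 ≤ a) (ha1 : a ≤ 1) :
    Tendsto (fun n : ℕ => ∫ x in a..(a + 1 / (2 * n)), deriv (sawtooth n) x * f x)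
      atTop (nhds 0) := by
  have hb := tendsto_h.const_mul C
  rw [mul_zero] at hb
  refine squeeze_zero_norm (fun n => ?_) hb
  have hh0 : (0:ℝ) ≤ 1 / (2 * n) := by positivity
  have := intervalIntegral.norm_integral_le_of_norm_le_const (a := a) (b := a + 1 / (2 * n))
    (f := fun x => deriv (sawtooth n) x * f x) (C := C) ?_
  · simpa [abs_of_nonneg hh0] using this
  · intro x hx
    rw [Set.uIoc_of_le (by linarith)] at hx
    have hx2 := h_le n
    have h1 := hC x ⟨by linarith [hx.1], by linarith [hx.2]⟩
    rw [norm_mul, Real.norm_eq_abs, Real.norm_eq_abs]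
    nlinarith [deriv_bound n x, abs_nonneg (f x), abs_nonneg (deriv (sawtooth n) x)]

lemma weak (f : ℝ → ℝ) (hf : Continuous f) :
    Tendsto (fun n : ℕ => ∫ x in (0:ℝ)..1, deriv (sawtooth n) x * f x) atTop (nhds 0) := by
  obtain ⟨C, hC⟩ := (isCompact_Icc (a := (0:ℝ)) (b := 2)).exists_bound_of_continuousOn
    hf.continuousOn
  simp only [Real.norm_eq_abs] at hC
  have hmain : Tendsto (fun n : ℕ =>
      ∫ x in (0:ℝ)..1, deriv (sawtooth n) x * (f x - f (x + 1 / (2 * n)))) atTop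
      (nhds (∫ x in (0:ℝ)..1, (0:ℝ))) := by
    apply intervalIntegral.tendsto_integral_filter_of_dominated_convergence (fun _ => 2 * C)
    · refine Eventually.of_forall fun n => ?_
      have hf' : Continuous fun x => f x - f (x + 1 / (2 * (n:ℝ))) := by fun_prop
      exact (measurable_deriv _).aestronglyMeasurable.mul hf'.aestronglyMeasurable
    · refine Eventually.of_forall fun n => Eventually.of_forall fun x hx => ?_
      rw [Set.uIoc_of_le (by norm_num)] at hx
      have hh0 : (0:ℝ) ≤ 1 / (2 * n) := by positivity
      have hx2 := h_le n
      have h1 := hC x ⟨by linarith [hx.1], by linarith [hx.2]⟩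
      have h2 := hC (x + 1 / (2 * n)) ⟨by linarith [hx.1], by linarith [hx.2]⟩
      have h3 := abs_sub (f x) (f (x + 1 / (2 * n)))
      rw [norm_mul, Real.norm_eq_abs, Real.norm_eq_abs]
      nlinarith [deriv_bound n x, abs_nonneg (f x - f (x + 1 / (2 * n))),
        abs_nonneg (deriv (sawtooth n) x)]
    · exact intervalIntegrable_const
    · refine Eventually.of_forall fun x _ => ?_
      have hd : Tendsto (fun n : ℕ => f x - f (x + 1 / (2 * (n:ℝ)))) atTop (nhds 0) := by
        have h1 : Tendsto (fun n : ℕ => x + 1 / (2 * (n:ℝ))) atTop (nhds x) := by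
          simpa only [add_zero] using tendsto_h.const_add x
        have h2 := ((hf.tendsto x).comp h1).const_sub (f x)
        simpa using h2
      have hd2 := hd.abs
      rw [abs_zero] at hd2
      refine squeeze_zero_norm (fun n => ?_) hd2
      rw [norm_mul, Real.norm_eq_abs, Real.norm_eq_abs]
      nlinarith [deriv_bound n x, abs_nonneg (f x - f (x + 1 / (2 * n))),
        abs_nonneg (deriv (sawtooth n) x)]
  have h := ((hmain.add (tendsto_small f C hC 0 le_rfl zero_le_one)).sub
    (tendsto_small f C hC 1 zero_le_one le_rfl)).const_mul (1/2)
  simp only [intervalIntegral.integral_zero, add_zero, sub_zero, mul_zero] at h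
  refine h.congr' ?_
  filter_upwards [eventually_ge_atTop 1] with n hn
  have := two_int hn f hf
  linarith

/-- The derivatives `vₙ = (sawtooth n)'` of the sawtooth minimizing sequence converge
weakly to `0` in `L²(0,1)` (they integrate to `0` against every continuous test
function in the limit), yet `‖vₙ‖_{L²(0,1)} = 1` for every `n ≥ 1`, so they do not
converge to `0` strongly in `L²(0,1)`. -/
theorem sawtooth_derivatives_weak_but_not_strong_convergence :
    (∀ φ : ℝ → ℝ, Continuous φ →
      Tendsto (fun n : ℕ => ∫ x in (0:ℝ)..1, deriv (sawtooth n) x * φ x)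
        atTop (nhds 0)) ∧
    (∀ n : ℕ, 1 ≤ n → (∫ x in (0:ℝ)..1, (deriv (sawtooth n) x) ^ 2) = 1) ∧
    ¬ Tendsto (fun n : ℕ => ∫ x in (0:ℝ)..1, (deriv (sawtooth n) x) ^ 2)
        atTop (nhds 0) := by
  refine ⟨weak, fun n hn => integral_sq hn, fun h => ?_⟩
  have h1 : Tendsto (fun n : ℕ => ∫ x in (0:ℝ)..1, (deriv (sawtooth n) x) ^ 2)
      atTop (nhds 1) := by
    refine tendsto_const_nhds.congr' ?_
    filter_upwards [eventually_ge_atTop 1] with n hn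
    exact (integral_sq hn).symm
  exact zero_ne_one (tendsto_nhds_unique h h1)
end

section
/- The zero function u ≡ 0 satisfies the Euler–Lagrange equation of I₁ (the function x ↦ (deriv u x) · ((deriv u x)² − 1) is constant) and the boundary conditions u(0) = u(1) = 0, yet it is not a minimizer of I₁: ∫_0^1 ((deriv 0 x)² − 1)² dx = 1, while there exists a Lipschitz function v with v(0) = v(1) = 0 and ∫_0^1 ((deriv v x)² − 1)² dx = 0 < 1. -/
open MeasureTheory

/-- The tent function has slope of modulus one away from its kink. -/
theorem tent_deriv_sq (x : ℝ) (hx : x ≠ 1 / 2) :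
    (deriv (fun y : ℝ => |y - 1 / 2| - 1 / 2) x) ^ 2 = 1 := by
  have hlin : HasDerivAt (fun y : ℝ => y - 1 / 2) 1 x := (hasDerivAt_id x).sub_const _
  rcases lt_or_gt_of_ne hx with h | h
  · have h1 : HasDerivAt (fun y : ℝ => |y - 1 / 2| - 1 / 2) (-1 * 1) x :=
      ((hasDerivAt_abs_neg (by linarith : x - 1 / 2 < 0)).comp x hlin).sub_const _
    rw [h1.deriv]; norm_num
  · have h1 : HasDerivAt (fun y : ℝ => |y - 1 / 2| - 1 / 2) (1 * 1) x :=
      ((hasDerivAt_abs_pos (by linarith : 0 < x - 1 / 2)).comp x hlin).sub_const _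
    rw [h1.deriv]; norm_num

/-- 1D Benchmark Problem #1, Euler–Lagrange (equation (7)): the zero function solves
the Euler–Lagrange equation `(d/dx)[u'(u'² − 1)] = 0` (the bracket is constant) and
the boundary conditions, yet it is not a minimizer of `I₁`: its energy is `1`, while
some admissible Lipschitz `v` has energy `0 < 1`. -/
theorem zero_solves_euler_lagrange_but_not_minimizer
    (u : ℝ → ℝ) (hu : ∀ x, u x = 0) :
    (∃ c : ℝ, ∀ x : ℝ, deriv u x * ((deriv u x) ^ 2 - 1) = c) ∧
    u 0 = 0 ∧ u 1 = 0 ∧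
    (∫ x in (0:ℝ)..1, ((deriv u x) ^ 2 - 1) ^ 2) = 1 ∧
    ∃ v : ℝ → ℝ, (∃ K, LipschitzWith K v) ∧ v 0 = 0 ∧ v 1 = 0 ∧
      (∫ x in (0:ℝ)..1, ((deriv v x) ^ 2 - 1) ^ 2) = 0 ∧
      (∫ x in (0:ℝ)..1, ((deriv v x) ^ 2 - 1) ^ 2) <
        (∫ x in (0:ℝ)..1, ((deriv u x) ^ 2 - 1) ^ 2) := by
  obtain rfl : u = fun _ => 0 := funext hu
  have h1 : (∫ x in (0:ℝ)..1, ((deriv (fun _ : ℝ => (0:ℝ)) x) ^ 2 - 1) ^ 2) = 1 := by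
    simp
  have h0 : (∫ x in (0:ℝ)..1,
      ((deriv (fun y : ℝ => |y - 1 / 2| - 1 / 2) x) ^ 2 - 1) ^ 2) = 0 := by
    apply intervalIntegral.integral_zero_ae
    filter_upwards [Measure.ae_ne volume (1 / 2 : ℝ)] with x hx _
    rw [tent_deriv_sq x hx]; norm_num
  refine ⟨⟨0, by simp⟩, rfl, rfl, h1, fun y => |y - 1 / 2| - 1 / 2, ⟨1, ?_⟩, ?_, ?_, h0, ?_⟩
  · apply LipschitzWith.of_dist_le_mul
    intro x y
    have h := abs_abs_sub_abs_le_abs_sub (x - 1 / 2) (y - 1 / 2)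
    simp only [Real.dist_eq, NNReal.coe_one, one_mul]
    simpa using h
  · norm_num [abs_of_neg]
  · norm_num [abs_of_pos]
  · rw [h0, h1]; norm_num
end

section
/- Let u : ℝ × ℝ → ℝ be Lipschitz with u(x, y) = 0 for every (x, y) on the boundary of the unit square [0,1] × [0,1]. Then ∫_{[0,1]²} ((∂ₓu)(x,y))² + (((∂_y u)(x,y))² − 1)² d(x,y) > 0, where ∂ₓu and ∂_y u denote the a.e.-defined partial derivatives of the Lipschitz function u. In particular, the infimum of J over this admissible class is not attained. -/
open MeasureTheory

/-- The integrand. -/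
noncomputable def tbF (u : ℝ × ℝ → ℝ) (p : ℝ × ℝ) : ℝ :=
  ((deriv (fun s => u (s, p.2)) p.1) ^ 2 + ((deriv (fun s => u (p.1, s)) p.2) ^ 2 - 1) ^ 2)

lemma tbF_nonneg (u : ℝ × ℝ → ℝ) (p : ℝ × ℝ) : 0 ≤ tbF u p := by
  unfold tbF; positivity

lemma tb_lip_fst {u : ℝ × ℝ → ℝ} {K : NNReal} (h : LipschitzWith K u) (y : ℝ) :
    LipschitzWith K (fun s => u (s, y)) := by
  have := h.comp (LipschitzWith.prodMk_right y)
  simpa [Function.comp_def] using this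

lemma tb_lip_snd {u : ℝ × ℝ → ℝ} {K : NNReal} (h : LipschitzWith K u) (x : ℝ) :
    LipschitzWith K (fun s => u (x, s)) := by
  have := h.comp (LipschitzWith.prodMk_left x)
  simpa [Function.comp_def] using this

lemma tbF_measurable {u : ℝ × ℝ → ℝ} (h : Continuous u) : Measurable (tbF u) := by
  have h2 : Measurable (fun p : ℝ × ℝ => deriv (fun s => u (p.1, s)) p.2) :=
    measurable_deriv_with_param (f := fun x s => u (x, s)) h
  have h1 : Measurable (fun p : ℝ × ℝ => deriv (fun s => u (s, p.1)) p.2) :=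
    measurable_deriv_with_param (f := fun y s => u (s, y)) (h.comp continuous_swap)
  have h1' : Measurable (fun p : ℝ × ℝ => deriv (fun s => u (s, p.2)) p.1) :=
    h1.comp measurable_swap
  unfold tbF
  fun_prop

lemma tbF_bound {u : ℝ × ℝ → ℝ} {K : NNReal} (h : LipschitzWith K u) (p : ℝ × ℝ) :
    ‖tbF u p‖ ≤ (K : ℝ) ^ 2 + ((K : ℝ) ^ 2 + 1) ^ 2 := by
  rw [Real.norm_of_nonneg (tbF_nonneg u p)]
  have h1 := norm_deriv_le_of_lipschitz (tb_lip_fst h p.2) (x₀ := p.1)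
  have h2 := norm_deriv_le_of_lipschitz (tb_lip_snd h p.1) (x₀ := p.2)
  unfold tbF
  rw [Real.norm_eq_abs] at h1 h2
  have h1' := sq_le_sq' (abs_le.1 h1).1 (abs_le.1 h1).2
  have h2' := sq_le_sq' (abs_le.1 h2).1 (abs_le.1 h2).2
  have h3 := sq_nonneg (deriv (fun s => u (p.1, s)) p.2)
  have := sq_le_sq' (a := (deriv (fun s => u (p.1, s)) p.2) ^ 2 - 1) (b := (K : ℝ) ^ 2 + 1)
    (by nlinarith [sq_nonneg (K : ℝ)]) (by linarith)
  linarith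

lemma tbF_bound_one {u : ℝ × ℝ → ℝ} (h : LipschitzWith 1 u) (p : ℝ × ℝ) :
    ‖tbF u p‖ ≤ 2 := by
  rw [Real.norm_of_nonneg (tbF_nonneg u p)]
  have h1 := norm_deriv_le_of_lipschitz (tb_lip_fst h p.2) (x₀ := p.1)
  have h2 := norm_deriv_le_of_lipschitz (tb_lip_snd h p.1) (x₀ := p.2)
  unfold tbF
  rw [Real.norm_eq_abs] at h1 h2
  have h1' := sq_le_sq' (abs_le.1 h1).1 (abs_le.1 h1).2
  have h2' := sq_le_sq' (abs_le.1 h2).1 (abs_le.1 h2).2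
  have h3 := sq_nonneg (deriv (fun s => u (p.1, s)) p.2)
  simp only [NNReal.coe_one, one_pow] at h1' h2'
  nlinarith

/-- The unit square. -/
def tbQ : Set (ℝ × ℝ) := Set.Icc (0:ℝ) 1 ×ˢ Set.Icc (0:ℝ) 1

lemma tbQ_meas : MeasurableSet tbQ := measurableSet_Icc.prod measurableSet_Icc

lemma tbF_integrable {u : ℝ × ℝ → ℝ} {K : NNReal} (h : LipschitzWith K u) :
    IntegrableOn (tbF u) tbQ := by
  refine Measure.integrableOn_of_bounded (M := (K : ℝ) ^ 2 + ((K : ℝ) ^ 2 + 1) ^ 2) ?_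
    (tbF_measurable h.continuous).aestronglyMeasurable
    (Filter.Eventually.of_forall (tbF_bound h))
  exact (isCompact_Icc.prod isCompact_Icc).measure_lt_top.ne

lemma tb_frontier (p : ℝ × ℝ) : p ∈ frontier tbQ ↔
    (p.1 ∈ Set.Icc (0:ℝ) 1 ∧ (p.2 = 0 ∨ p.2 = 1)) ∨
      ((p.1 = 0 ∨ p.1 = 1) ∧ p.2 ∈ Set.Icc (0:ℝ) 1) := by
  unfold tbQ
  rw [frontier_prod_eq, frontier_Icc zero_le_one]
  simp [closure_Icc]

lemma tb_pos {u : ℝ × ℝ → ℝ} {K : NNReal} (h : LipschitzWith K u)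
    (hb : ∀ p ∈ frontier tbQ, u p = 0) : 0 < ∫ p in tbQ, tbF u p := by
  have hnn : 0 ≤ ∫ p in tbQ, tbF u p := integral_nonneg (tbF_nonneg u)
  refine lt_of_le_of_ne hnn fun h0 => ?_
  have hae : tbF u =ᵐ[volume.restrict tbQ] 0 :=
    (setIntegral_eq_zero_iff_of_nonneg_ae (Filter.Eventually.of_forall (tbF_nonneg u))
      (tbF_integrable h)).1 h0.symm
  -- swap and slice
  have hae2 : ∀ᵐ y ∂(volume.restrict (Set.Icc (0:ℝ) 1)),
      ∀ᵐ x ∂(volume.restrict (Set.Icc (0:ℝ) 1)), tbF u (x, y) = 0 := by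
    have e : (volume.restrict tbQ : Measure (ℝ × ℝ)) =
        (volume.restrict (Set.Icc (0:ℝ) 1)).prod (volume.restrict (Set.Icc (0:ℝ) 1)) := by
      rw [Measure.prod_restrict]; rfl
    rw [e, ← Measure.prod_swap] at hae
    exact Measure.ae_ae_of_ae_prod (ae_of_ae_map measurable_swap.aemeasurable hae)
  have hzero : ∀ x ∈ Set.Icc (0:ℝ) 1, ∀ y ∈ Set.Icc (0:ℝ) 1, u (x, y) = 0 := by
    intro x hx
    have : (fun y => u (x, y)) =ᵐ[volume.restrict (Set.Icc (0:ℝ) 1)] fun _ => 0 := by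
      filter_upwards [hae2, ae_restrict_mem measurableSet_Icc] with y hy hyI
      have hAC : AbsolutelyContinuousOnInterval (fun s => u (s, y)) 0 x :=
        ((tb_lip_fst h y).lipschitzOnWith).absolutelyContinuousOnInterval
      have hi := hAC.integral_deriv_eq_sub
      have hz : ∫ s in (0:ℝ)..x, deriv (fun s => u (s, y)) s = 0 := by
        apply intervalIntegral.integral_zero_ae
        rw [ae_restrict_iff' measurableSet_Icc] at hy
        filter_upwards [hy] with s hs hsI
        rw [Set.uIoc_of_le hx.1] at hsI
        have := hs ⟨hsI.1.le, hsI.2.trans hx.2⟩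
        unfold tbF at this
        simp only at this
        nlinarith [sq_nonneg (deriv (fun s => u (s, y)) s),
          sq_nonneg ((deriv (fun t => u (s, t)) y) ^ 2 - 1)]
      have h00 : u (0, y) = 0 := hb _ ((tb_frontier _).2 (Or.inr ⟨Or.inl rfl, hyI⟩))
      rw [hz] at hi
      simp only [h00] at hi
      linarith
    exact Measure.eqOn_Icc_of_ae_eq volume zero_ne_one this
      (tb_lip_snd h x).continuous.continuousOn continuousOn_const
  rw [Filter.EventuallyEq, ae_restrict_iff' tbQ_meas] at hae
  have hsub : Set.Ioo (0:ℝ) 1 ×ˢ Set.Ioo (0:ℝ) 1 ⊆ {p | ¬ (p ∈ tbQ → tbF u p = (0 : ℝ × ℝ → ℝ) p)} := by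
    rintro ⟨x, y⟩ ⟨hx, hy⟩ hc
    have hc := hc ⟨Set.Ioo_subset_Icc_self hx, Set.Ioo_subset_Icc_self hy⟩
    have hd : deriv (fun s => u (x, s)) y = 0 := by
      have : (fun s => u (x, s)) =ᶠ[nhds y] fun _ => 0 := by
        filter_upwards [Ioo_mem_nhds hy.1 hy.2] with s hs
        exact hzero x (Set.Ioo_subset_Icc_self hx) s (Set.Ioo_subset_Icc_self hs)
      rw [this.deriv_eq, deriv_const]
    simp only [tbF, hd, Pi.zero_apply] at hc
    nlinarith [sq_nonneg (deriv (fun s => u (s, y)) x)]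
  have h1 := measure_mono_null hsub hae
  have h2 : 0 < volume (Set.Ioo (0:ℝ) 1 ×ˢ Set.Ioo (0:ℝ) 1) :=
    (isOpen_Ioo.prod isOpen_Ioo).measure_pos volume ⟨(1/2, 1/2), by norm_num⟩
  exact h2.ne' h1

/-- Sawtooth of slope one and period `1/n`. -/
noncomputable def tbW (n : ℕ) (y : ℝ) : ℝ := |n * y - round (n * y)| / n

lemma tbW_nonneg (n : ℕ) (y : ℝ) : 0 ≤ tbW n y := by unfold tbW; positivity

lemma tbW_lip (n : ℕ) (hn : 0 < n) : LipschitzWith 1 (tbW n) := by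
  refine LipschitzWith.of_le_add fun a b => ?_
  have hn' : (0:ℝ) < n := by exact_mod_cast hn
  unfold tbW
  rw [div_le_iff₀ hn', add_mul, div_mul_cancel₀ _ hn'.ne']
  have h1 := round_le (n * a : ℝ) (round (n * b : ℝ))
  have h2 := abs_add_le (n * b - round (n * b : ℝ) : ℝ) (n * a - n * b)
  have h3 : |(n * a - n * b : ℝ)| = dist a b * n := by
    rw [← mul_sub, abs_mul, abs_of_pos hn', Real.dist_eq, mul_comm]
  have h4 : (n * b - round (n * b : ℝ) : ℝ) + (n * a - n * b) = n * a - round (n * b : ℝ) := by ring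
  rw [h4] at h2
  linarith

lemma tbW_le (n : ℕ) (hn : 0 < n) (y : ℝ) : tbW n y < 1 / n := by
  have hn' : (0:ℝ) < n := by exact_mod_cast hn
  unfold tbW
  gcongr
  linarith [abs_sub_round (n * y : ℝ)]

lemma tbW_deriv (n : ℕ) (hn : 0 < n) (y : ℝ) (hy : ∀ k : ℤ, y ≠ k / (2 * n)) :
    (deriv (tbW n) y) ^ 2 = 1 := by
  have hn' : (0:ℝ) < n := by exact_mod_cast hn
  obtain ⟨k, hk⟩ : ∃ k : ℤ, k = round (n * y : ℝ) := ⟨_, rfl⟩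
  have hy' : ∀ k : ℤ, 2 * (n * y) ≠ k := by
    intro k h
    apply hy k
    rw [← h]; field_simp
  have hmem := round_eq_iff.1 hk.symm
  have hlt : (k - 1 / 2 : ℝ) < n * y := by
    refine lt_of_le_of_ne hmem.1 fun e => hy' (2 * k - 1) ?_
    push_cast; linarith
  have hne : (n * y - k : ℝ) ≠ 0 := by
    intro e
    apply hy' (2 * k); push_cast; linarith
  have hcont : Continuous fun s : ℝ => (n * s : ℝ) := by fun_prop
  have hev : tbW n =ᶠ[nhds y] fun s => |n * s - k| / n := by
    filter_upwards [hcont.continuousAt.preimage_mem_nhds (Ioo_mem_nhds hlt hmem.2)] with s hs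
    have : round (n * s : ℝ) = k := round_eq_iff.2 ⟨hs.1.le, hs.2⟩
    simp only [tbW, this]
  rw [hev.deriv_eq]
  have hd : HasDerivAt (fun s : ℝ => (n * s - k : ℝ)) (n : ℝ) y := by
    simpa using ((hasDerivAt_id y).const_mul (n : ℝ)).sub_const (k : ℝ)
  rcases lt_or_gt_of_ne hne with hl | hl
  · have := ((hasDerivAt_abs_neg hl).comp y hd).div_const (n : ℝ)
    have h2 := this.deriv
    simp only [Function.comp_def] at h2
    rw [h2]; field_simp
  · have := ((hasDerivAt_abs_pos hl).comp y hd).div_const (n : ℝ)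
    have h2 := this.deriv
    simp only [Function.comp_def] at h2
    rw [h2]; field_simp

/-- The competitor. -/
noncomputable def tbV (n : ℕ) (p : ℝ × ℝ) : ℝ := min (min p.1 (1 - p.1)) (tbW n p.2)

lemma tbV_lip (n : ℕ) (hn : 0 < n) : LipschitzWith 1 (tbV n) := by
  have h1 : LipschitzWith 1 (fun p : ℝ × ℝ => p.1) := LipschitzWith.prod_fst
  have h2 : LipschitzWith 1 (fun p : ℝ × ℝ => 1 - p.1) := by
    refine LipschitzWith.of_dist_le_mul fun a b => ?_
    have := h1.dist_le_mul a b
    rw [Real.dist_eq] at *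
    rw [show (1 - a.1 - (1 - b.1)) = -(a.1 - b.1) by ring, abs_neg]
    exact this
  have h3 : LipschitzWith 1 (fun p : ℝ × ℝ => tbW n p.2) := by
    simpa [Function.comp_def] using (tbW_lip n hn).comp (LipschitzWith.prod_snd (α := ℝ) (β := ℝ))
  have := (h1.min h2).min h3
  simp only [max_self] at this
  exact this

lemma tbV_bdry (n : ℕ) (p : ℝ × ℝ) (hp : p ∈ frontier tbQ) : tbV n p = 0 := by
  have hw := tbW_nonneg n p.2
  rcases (tb_frontier p).1 hp with ⟨hx, hy⟩ | ⟨hx, hy⟩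
  · have : tbW n p.2 = 0 := by
      rcases hy with hy | hy <;> simp [tbW, hy]
    unfold tbV
    rw [this]
    exact min_eq_right (le_min hx.1 (by linarith [hx.2]))
  · unfold tbV
    have : min p.1 (1 - p.1) = 0 := by rcases hx with hx | hx <;> simp [hx]
    rw [this]; exact min_eq_left hw

/-- Two boundary strips. -/
def tbT (n : ℕ) : Set (ℝ × ℝ) :=
  (Set.Icc (0:ℝ) (1 / n) ∪ Set.Icc (1 - 1 / n : ℝ) 1) ×ˢ Set.Icc (0:ℝ) 1

lemma tbT_vol (n : ℕ) : volume (tbT n) ≤ ENNReal.ofReal (2 / n) := by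
  unfold tbT
  rw [Measure.volume_eq_prod, Measure.prod_prod]
  simp only [Real.volume_Icc, sub_zero, ENNReal.ofReal_one, mul_one]
  refine (measure_union_le _ _).trans ?_
  rw [Real.volume_Icc, Real.volume_Icc, ← ENNReal.ofReal_add (by simp) (by simp)]
  apply ENNReal.ofReal_le_ofReal
  apply le_of_eq; ring

lemma tbV_energy (n : ℕ) (hn : 0 < n) : ∫ p in tbQ, tbF (tbV n) p ≤ 4 / n := by
  have hn' : (0:ℝ) < n := by exact_mod_cast hn
  have hn1 : (1 / n : ℝ) ≤ 1 := by
    rw [div_le_one hn']; exact_mod_cast hn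
  have hTQ : tbT n ⊆ tbQ := by
    apply Set.prod_mono_left
    apply Set.union_subset
    · exact Set.Icc_subset_Icc_right hn1
    · exact Set.Icc_subset_Icc_left (by linarith)
  -- null set of bad heights
  have hnull : ∀ᵐ p : ℝ × ℝ, ∀ k : ℤ, p.2 ≠ k / (2 * n) := by
    have h1 : ∀ᵐ y : ℝ, ∀ k : ℤ, y ≠ k / (2 * n) := by
      rw [ae_all_iff]
      intro k
      exact Measure.ae_ne volume _
    exact (Measure.quasiMeasurePreserving_snd (μ := (volume : Measure ℝ))
      (ν := (volume : Measure ℝ))).ae h1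
  have hz : ∀ᵐ p : ℝ × ℝ, p ∈ tbQ \ tbT n → tbF (tbV n) p = 0 := by
    filter_upwards [hnull] with p hp ⟨hQ, hT⟩
    obtain ⟨x, y⟩ := p
    obtain ⟨hx, hy⟩ := hQ
    simp only at hx hy hp
    have hx1 : 1 / n < x := by
      by_contra hc
      exact hT ⟨Or.inl ⟨hx.1, not_lt.1 hc⟩, hy⟩
    have hx2 : x < 1 - 1 / n := by
      by_contra hc
      exact hT ⟨Or.inr ⟨not_lt.1 hc, hx.2⟩, hy⟩
    have key : ∀ s t : ℝ, 1 / n < s → s < 1 - 1 / n → tbV n (s, t) = tbW n t := by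
      intro s t h1 h2
      have := tbW_le n hn t
      exact min_eq_right (le_min (by simp only; linarith) (by simp only; linarith))
    have hd1 : deriv (fun s => tbV n (s, y)) x = 0 := by
      have : (fun s => tbV n (s, y)) =ᶠ[nhds x] fun _ => tbW n y := by
        filter_upwards [Ioo_mem_nhds hx1 hx2] with s hs
        exact key s y hs.1 hs.2
      rw [this.deriv_eq, deriv_const]
    have hd2 : (fun s => tbV n (x, s)) = tbW n := by
      funext s; exact key x s hx1 hx2
    simp only [tbF, hd1, hd2, tbW_deriv n hn y hp]
    norm_num
  rw [setIntegral_eq_of_subset_of_ae_sdiff_eq_zero tbQ_meas.nullMeasurableSet hTQ hz]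
  have hlt : volume (tbT n) < ⊤ := (tbT_vol n).trans_lt ENNReal.ofReal_lt_top
  have hI := norm_setIntegral_le_of_norm_le_const (f := tbF (tbV n)) hlt
    (fun p _ => tbF_bound_one (tbV_lip n hn) p)
  have hr : volume.real (tbT n) ≤ 2 / n :=
    ENNReal.toReal_le_of_le_ofReal (by positivity) (tbT_vol n)
  calc _ ≤ _ := le_abs_self _
    _ ≤ _ := hI
    _ ≤ 2 * (2 / n) := by gcongr
    _ = 4 / n := by ring

/-- 2D Benchmark Problem (twin branching): every Lipschitz `u : ℝ × ℝ → ℝ` vanishing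
on the boundary of the unit square has strictly positive energy
`J(u) = ∫_{[0,1]²} (∂ₓu)² + ((∂_y u)² − 1)² > 0`; in particular the infimum of `J`
over this admissible class is not attained (there is no minimizer). -/
theorem twin_branching_no_minimizer :
    (∀ u : ℝ × ℝ → ℝ, (∃ K, LipschitzWith K u) →
      (∀ p ∈ frontier (Set.Icc (0:ℝ) 1 ×ˢ Set.Icc (0:ℝ) 1), u p = 0) →
      0 < ∫ p in Set.Icc (0:ℝ) 1 ×ˢ Set.Icc (0:ℝ) 1,
        ((deriv (fun s => u (s, p.2)) p.1) ^ 2 +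
          ((deriv (fun s => u (p.1, s)) p.2) ^ 2 - 1) ^ 2)) ∧
    ¬ ∃ u : ℝ × ℝ → ℝ, (∃ K, LipschitzWith K u) ∧
      (∀ p ∈ frontier (Set.Icc (0:ℝ) 1 ×ˢ Set.Icc (0:ℝ) 1), u p = 0) ∧
      ∀ v : ℝ × ℝ → ℝ, (∃ K, LipschitzWith K v) →
        (∀ p ∈ frontier (Set.Icc (0:ℝ) 1 ×ˢ Set.Icc (0:ℝ) 1), v p = 0) →
        (∫ p in Set.Icc (0:ℝ) 1 ×ˢ Set.Icc (0:ℝ) 1,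
          ((deriv (fun s => u (s, p.2)) p.1) ^ 2 +
            ((deriv (fun s => u (p.1, s)) p.2) ^ 2 - 1) ^ 2)) ≤
        (∫ p in Set.Icc (0:ℝ) 1 ×ˢ Set.Icc (0:ℝ) 1,
          ((deriv (fun s => v (s, p.2)) p.1) ^ 2 +
            ((deriv (fun s => v (p.1, s)) p.2) ^ 2 - 1) ^ 2)) := by
  refine ⟨?_, ?_⟩
  · rintro u ⟨K, hK⟩ hb
    exact tb_pos hK hb
  · rintro ⟨u, ⟨K, hK⟩, hb, hmin⟩
    have hpos : 0 < ∫ p in tbQ, tbF u p := tb_pos hK hb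
    obtain ⟨n, hn⟩ := exists_nat_gt (4 / ∫ p in tbQ, tbF u p)
    have hn' : (0:ℝ) < n := lt_trans (by positivity) hn
    have hn0 : 0 < n := by exact_mod_cast hn'
    have h1 : ∫ p in tbQ, tbF u p ≤ ∫ p in tbQ, tbF (tbV n) p :=
      hmin (tbV n) ⟨1, tbV_lip n hn0⟩ (tbV_bdry n)
    have h2 := tbV_energy n hn0
    rw [div_lt_iff₀ hpos] at hn
    have h3 : 4 / (n : ℝ) < ∫ p in tbQ, tbF u p := by
      rw [div_lt_iff₀ hn']; linarith
    linarith
end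

section
/- For every ε > 0 there exists a Lipschitz function u : ℝ × ℝ → ℝ with u(x, y) = 0 for every (x, y) on the boundary of the unit square [0,1] × [0,1], such that ∫_{[0,1]²} ((∂ₓu)(x,y))² + (((∂_y u)(x,y))² − 1)² d(x,y) < ε. Hence the infimum of J over this admissible class equals 0. -/
open MeasureTheory

noncomputable def twT (p : ℝ) (y : ℝ) : ℝ := ‖(y : AddCircle p)‖

noncomputable def twU (p : ℝ) (q : ℝ × ℝ) : ℝ := min (twT p q.2) (min q.1 (1 - q.1))

lemma twT_lip (p : ℝ) : LipschitzWith 1 (twT p) := by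
  refine LipschitzWith.of_dist_le_mul fun x y => ?_
  have h1 : ‖((x - y : ℝ) : AddCircle p)‖ ≤ ‖x - y‖ := by
    exact QuotientAddGroup.norm_mk_le_norm
  have := abs_norm_sub_norm_le (x : AddCircle p) (y : AddCircle p)
  rw [← AddCircle.coe_sub] at this
  simpa [Real.dist_eq, twT] using this.trans h1

lemma twT_nonneg (p y : ℝ) : 0 ≤ twT p y := norm_nonneg _

lemma twT_le (p y : ℝ) (hp : 0 < p) : twT p y ≤ p / 2 := by
  have := AddCircle.norm_le_half_period (x := (y : AddCircle p)) p hp.ne'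
  rwa [abs_of_pos hp] at this

lemma phi_lip : LipschitzWith 1 (fun x : ℝ => min x (1 - x)) := by
  have h : LipschitzWith 1 (fun x : ℝ => 1 - x) :=
    LipschitzWith.of_dist_le_mul fun x y => by
      rw [Real.dist_eq, Real.dist_eq, abs_sub_comm, NNReal.coe_one, one_mul]
      exact le_of_eq (by congr 1; ring)
  simpa using LipschitzWith.id.min h

lemma twU_lip (p : ℝ) : LipschitzWith 1 (twU p) := by
  have h1 := (twT_lip p).comp (LipschitzWith.prod_snd (α := ℝ) (β := ℝ))
  have h2 := phi_lip.comp (LipschitzWith.prod_fst (α := ℝ) (β := ℝ))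
  have h3 := h1.min h2
  simp only [mul_one, max_self] at h3
  exact h3

lemma twU_x_lip (p y : ℝ) : LipschitzWith 1 (fun s => twU p (s, y)) := by
  have h := (twU_lip p).comp (LipschitzWith.prodMk_right y)
  rw [mul_one] at h
  exact h

lemma twU_y_lip (p x : ℝ) : LipschitzWith 1 (fun s => twU p (x, s)) := by
  have h := (twU_lip p).comp (LipschitzWith.prodMk_left x)
  rw [mul_one] at h
  exact h

lemma twT_deriv (p : ℝ) (hp : 0 < p) (y : ℝ) (h1 : ∀ k : ℤ, y ≠ k * p)
    (h2 : ∀ k : ℤ, y ≠ (k - 1 / 2) * p) : (deriv (twT p) y) ^ 2 = 1 := by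
  set c : ℤ := round (p⁻¹ * y) with hc
  have hlt : ((⌊p⁻¹ * y + 1 / 2⌋ : ℤ) : ℝ) < p⁻¹ * y + 1 / 2 := by
    refine lt_of_le_of_ne (Int.floor_le _) fun h => ?_
    refine h2 ⌊p⁻¹ * y + 1 / 2⌋ ?_
    rw [h]; field_simp; ring
  have hlt2 := Int.lt_floor_add_one (p⁻¹ * y + 1 / 2)
  have hcont : Continuous fun s : ℝ => p⁻¹ * s + 1 / 2 := by fun_prop
  have hev : twT p =ᶠ[nhds y] fun s => |s - c * p| := by
    filter_upwards [hcont.continuousAt.eventually (lt_mem_nhds hlt),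
      hcont.continuousAt.eventually (gt_mem_nhds hlt2)] with s hs1 hs2
    have : round (p⁻¹ * s) = c := by
      rw [hc, round_eq, round_eq, Int.floor_eq_iff]
      exact ⟨hs1.le, hs2⟩
    rw [twT, AddCircle.norm_eq, this]
  rw [hev.deriv_eq]
  rcases lt_or_gt_of_ne (h1 c) with h | h
  · have : (fun s : ℝ => |s - c * p|) =ᶠ[nhds y] fun s => -(s - c * p) := by
      filter_upwards [gt_mem_nhds h] with s hs
      exact abs_of_neg (by linarith)
    rw [this.deriv_eq]; simp
  · have : (fun s : ℝ => |s - c * p|) =ᶠ[nhds y] fun s => (s - c * p) := by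
      filter_upwards [lt_mem_nhds h] with s hs
      exact abs_of_pos (by linarith)
    rw [this.deriv_eq]; simp

lemma ae_good (p : ℝ) : ∀ᵐ q : ℝ × ℝ, (∀ k : ℤ, q.2 ≠ k * p) ∧ (∀ k : ℤ, q.2 ≠ (k - 1 / 2) * p) := by
  have h : ∀ᵐ y : ℝ, (∀ k : ℤ, y ≠ k * p) ∧ (∀ k : ℤ, y ≠ (k - 1 / 2) * p) := by
    rw [Filter.eventually_and, ae_all_iff, ae_all_iff]
    exact ⟨fun k => Measure.ae_ne _ _, fun k => Measure.ae_ne _ _⟩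
  exact (Measure.quasiMeasurePreserving_snd (μ := (volume : Measure ℝ))
    (ν := (volume : Measure ℝ))).ae h

lemma twU_energy (p : ℝ) (hp : 0 < p) (hp1 : p < 1) :
    (∫ q in Set.Icc (0:ℝ) 1 ×ˢ Set.Icc (0:ℝ) 1,
          ((deriv (fun s => twU p (s, q.2)) q.1) ^ 2 +
            ((deriv (fun s => twU p (q.1, s)) q.2) ^ 2 - 1) ^ 2)) ≤ 2 * p := by
  set A : Set (ℝ × ℝ) := Set.Icc (0:ℝ) (p / 2) ×ˢ Set.Icc (0:ℝ) 1 with hA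
  set B : Set (ℝ × ℝ) := Set.Icc (1 - p / 2) (1:ℝ) ×ˢ Set.Icc (0:ℝ) 1 with hB
  have hAm : MeasurableSet A := measurableSet_Icc.prod measurableSet_Icc
  have hBm : MeasurableSet B := measurableSet_Icc.prod measurableSet_Icc
  have hQm : MeasurableSet (Set.Icc (0:ℝ) 1 ×ˢ Set.Icc (0:ℝ) 1) :=
    measurableSet_Icc.prod measurableSet_Icc
  have hvA : volume.real A = p / 2 := by
    rw [hA, Measure.volume_eq_prod, measureReal_prod_prod]
    simp
    positivity
  have hvB : volume.real B = p / 2 := by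
    rw [hB, Measure.volume_eq_prod, measureReal_prod_prod]
    simp
    positivity
  have hfA : volume A ≠ ⊤ := (isCompact_Icc.prod isCompact_Icc).measure_ne_top
  have hfB : volume B ≠ ⊤ := (isCompact_Icc.prod isCompact_Icc).measure_ne_top
  have hiA : Integrable (A.indicator fun _ => (2:ℝ)) :=
    (integrable_indicator_iff hAm).2 (integrableOn_const hfA)
  have hiB : Integrable (B.indicator fun _ => (2:ℝ)) :=
    (integrable_indicator_iff hBm).2 (integrableOn_const hfB)
  have hA0 : ∀ q, 0 ≤ A.indicator (fun _ => (2:ℝ)) q :=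
    fun q => Set.indicator_nonneg (fun _ _ => by norm_num) q
  have hB0 : ∀ q, 0 ≤ B.indicator (fun _ => (2:ℝ)) q :=
    fun q => Set.indicator_nonneg (fun _ _ => by norm_num) q
  calc _ ≤ ∫ q in Set.Icc (0:ℝ) 1 ×ˢ Set.Icc (0:ℝ) 1,
        (A.indicator (fun _ => (2:ℝ)) q + B.indicator (fun _ => (2:ℝ)) q) := by
        refine integral_mono_of_nonneg (.of_forall fun q => by positivity)
          (hiA.add hiB).integrableOn ?_
        filter_upwards [ae_restrict_mem hQm, ae_restrict_of_ae (ae_good p)] with q hq hg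
        have hx : |deriv (fun s => twU p (s, q.2)) q.1| ≤ 1 := by
          simpa using norm_deriv_le_of_lipschitz (x₀ := q.1) (twU_x_lip p q.2)
        have hy : |deriv (fun s => twU p (q.1, s)) q.2| ≤ 1 := by
          simpa using norm_deriv_le_of_lipschitz (x₀ := q.2) (twU_y_lip p q.1)
        have hle : (deriv (fun s => twU p (s, q.2)) q.1) ^ 2 +
            ((deriv (fun s => twU p (q.1, s)) q.2) ^ 2 - 1) ^ 2 ≤ 2 := by
          have h1 := (sq_le_one_iff_abs_le_one _).2 hx
          have h2 := (sq_le_one_iff_abs_le_one _).2 hy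
          have h3 := sq_nonneg (deriv (fun s => twU p (q.1, s)) q.2)
          nlinarith
        obtain ⟨⟨hq1, hq2⟩, hq3⟩ := hq
        by_cases hqA : q.1 ≤ p / 2
        · have : q ∈ A := ⟨⟨hq1, hqA⟩, hq3⟩
          have h := hB0 q
          rw [Set.indicator_of_mem this]
          linarith
        by_cases hqB : 1 - p / 2 ≤ q.1
        · have : q ∈ B := ⟨⟨hqB, hq2⟩, hq3⟩
          have h := hA0 q
          rw [Set.indicator_of_mem this]
          linarith
        push Not at hqA hqB
        have key : ∀ a b, p / 2 < a → a < 1 - p / 2 → twU p (a, b) = twT p b := by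
          intro a b h1 h2
          have := twT_le p b hp
          exact min_eq_left (le_min (by linarith) (by simp only; linarith))
        have e1 : deriv (fun s => twU p (s, q.2)) q.1 = 0 := by
          have : (fun s => twU p (s, q.2)) =ᶠ[nhds q.1] fun _ => twT p q.2 := by
            filter_upwards [lt_mem_nhds hqA, gt_mem_nhds hqB] with s h1 h2
            exact key s _ h1 h2
          rw [this.deriv_eq]; simp
        have e2 : (fun s => twU p (q.1, s)) = twT p := funext fun s => key _ _ hqA hqB
        rw [e1, e2, twT_deriv p hp _ hg.1 hg.2]
        have := hA0 q
        have := hB0 q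
        norm_num
        linarith
    _ ≤ ∫ q, (A.indicator (fun _ => (2:ℝ)) q + B.indicator (fun _ => (2:ℝ)) q) :=
        setIntegral_le_integral (hiA.add hiB) (.of_forall fun q => add_nonneg (hA0 q) (hB0 q))
    _ = 2 * p := by
        rw [integral_add hiA hiB, integral_indicator_const _ hAm, integral_indicator_const _ hBm,
          hvA, hvB]
        simp; ring

lemma twU_bdry (p : ℝ) (hp : 0 < p) (n : ℕ) (hn : n * p = 1) :
    ∀ q ∈ frontier (Set.Icc (0:ℝ) 1 ×ˢ Set.Icc (0:ℝ) 1), twU p q = 0 := by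
  rintro ⟨x, y⟩ hq
  rw [frontier_prod_eq, closure_Icc, frontier_Icc zero_le_one] at hq
  have hT0 : twT p 0 = 0 := by simp [twT]
  have hT1 : twT p 1 = 0 := by
    have : ((1 : ℝ) : AddCircle p) = 0 := by
      rw [AddCircle.coe_eq_zero_iff]
      exact ⟨n, by simpa using hn⟩
    simp [twT, this]
  simp only [twU]
  have := twT_nonneg p y
  rcases hq with ⟨⟨h1, h2⟩, h3⟩ | ⟨h3, -⟩
  · have hm : (0:ℝ) ≤ min x (1 - x) := le_min h1 (by simp only at h2; linarith)
    rcases h3 with h3 | h3 <;> simp only [Set.mem_singleton_iff] at h3 <;> subst h3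
    · rw [hT0, min_eq_left hm]
    · rw [hT1, min_eq_left hm]
  · rcases h3 with h3 | h3 <;> simp only [Set.mem_singleton_iff] at h3 <;> subst h3 <;> simpa

/-- 2D Benchmark Problem (twin branching): for every `ε > 0` there is a Lipschitz
`u : ℝ × ℝ → ℝ` vanishing on the boundary of the unit square with energy
`J(u) = ∫_{[0,1]²} (∂ₓu)² + ((∂_y u)² − 1)² < ε`; hence the infimum of `J` over this
admissible class equals `0`. -/
theorem twin_branching_infimum_zero :
    (∀ ε : ℝ, 0 < ε →
      ∃ u : ℝ × ℝ → ℝ, (∃ K, LipschitzWith K u) ∧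
        (∀ p ∈ frontier (Set.Icc (0:ℝ) 1 ×ˢ Set.Icc (0:ℝ) 1), u p = 0) ∧
        (∫ p in Set.Icc (0:ℝ) 1 ×ˢ Set.Icc (0:ℝ) 1,
          ((deriv (fun s => u (s, p.2)) p.1) ^ 2 +
            ((deriv (fun s => u (p.1, s)) p.2) ^ 2 - 1) ^ 2)) < ε) ∧
    sInf {c : ℝ | ∃ u : ℝ × ℝ → ℝ, (∃ K, LipschitzWith K u) ∧
      (∀ p ∈ frontier (Set.Icc (0:ℝ) 1 ×ˢ Set.Icc (0:ℝ) 1), u p = 0) ∧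
      c = ∫ p in Set.Icc (0:ℝ) 1 ×ˢ Set.Icc (0:ℝ) 1,
        ((deriv (fun s => u (s, p.2)) p.1) ^ 2 +
          ((deriv (fun s => u (p.1, s)) p.2) ^ 2 - 1) ^ 2)} = 0 := by
  have main : ∀ ε : ℝ, 0 < ε →
      ∃ u : ℝ × ℝ → ℝ, (∃ K, LipschitzWith K u) ∧
        (∀ p ∈ frontier (Set.Icc (0:ℝ) 1 ×ˢ Set.Icc (0:ℝ) 1), u p = 0) ∧
        (∫ p in Set.Icc (0:ℝ) 1 ×ˢ Set.Icc (0:ℝ) 1,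
          ((deriv (fun s => u (s, p.2)) p.1) ^ 2 +
            ((deriv (fun s => u (p.1, s)) p.2) ^ 2 - 1) ^ 2)) < ε := by
    intro ε hε
    obtain ⟨n, hn⟩ := exists_nat_gt (max 1 (2 / ε))
    have hn1 : (1:ℝ) < n := (le_max_left _ _).trans_lt hn
    have hn2 : 2 / ε < n := (le_max_right _ _).trans_lt hn
    have hn0 : (0:ℝ) < n := by linarith
    have hp : (0:ℝ) < (n:ℝ)⁻¹ := inv_pos.2 hn0
    refine ⟨twU (n:ℝ)⁻¹, ⟨1, twU_lip _⟩, twU_bdry _ hp n (mul_inv_cancel₀ hn0.ne'),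
      (twU_energy _ hp (inv_lt_one_of_one_lt₀ hn1)).trans_lt ?_⟩
    rw [div_lt_iff₀ hε] at hn2
    rw [← div_eq_mul_inv, div_lt_iff₀ hn0]
    linarith
  refine ⟨main, ?_⟩
  have hlb : ∀ c ∈ {c : ℝ | ∃ u : ℝ × ℝ → ℝ, (∃ K, LipschitzWith K u) ∧
      (∀ p ∈ frontier (Set.Icc (0:ℝ) 1 ×ˢ Set.Icc (0:ℝ) 1), u p = 0) ∧
      c = ∫ p in Set.Icc (0:ℝ) 1 ×ˢ Set.Icc (0:ℝ) 1,
        ((deriv (fun s => u (s, p.2)) p.1) ^ 2 +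
          ((deriv (fun s => u (p.1, s)) p.2) ^ 2 - 1) ^ 2)}, 0 ≤ c := by
    rintro c ⟨u, -, -, rfl⟩
    exact integral_nonneg fun q => by positivity
  refine le_antisymm (le_of_forall_pos_lt_add fun ε hε => ?_) (Real.sInf_nonneg hlb)
  obtain ⟨u, h1, h2, h3⟩ := main ε hε
  rw [zero_add]
  exact (csInf_le ⟨0, hlb⟩ ⟨u, h1, h2, rfl⟩).trans_lt h3
end
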